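/- arXiv:2502.04136 — 4 statements merged into one kernel-verified Lean document; each statement's English description precedes it below -/
import Mathlib

section
/- For all r ≥ 2 and n ≥ 1, the number of permutations of {1,...,n} all of whose cycle lengths are divisible by r is at most the number of permutations of {1,...,n} none of whose cycle lengths is divisible by r, with equality if and only if r = 2 and n is even. -/
open Function Equiv

section Insertion

variable {α β : Type*}

theorem minimalPeriod_eq_of_iterate {f : α → α} {g : β → β} {i : α → β} (hi : Injective i) {x : α}
    (h : ∀ j, g^[j] (i x) = i (f^[j] x)) : minimalPeriod g (i x) = minimalPeriod f x := by
  rw [minimalPeriod_eq_minimalPeriod_iff]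
  intro j
  rw [IsPeriodicPt, IsFixedPt, h, hi.eq_iff, IsPeriodicPt, IsFixedPt]

theorem Equiv.Perm.minimalPeriod_pos [Finite α] (σ : Perm α) (x : α) : 0 < minimalPeriod σ x :=
  minimalPeriod_pos_of_mem_periodicPts (σ.injective.mem_periodicPts x)

theorem Equiv.Perm.SameCycle.minimalPeriod_eq [Finite α] {σ : Perm α} {x y : α}
    (h : σ.SameCycle x y) : minimalPeriod σ y = minimalPeriod σ x := by
  obtain ⟨i, rfl⟩ := h.exists_nat_pow_eq
  rw [Perm.coe_pow, minimalPeriod_apply_iterate (σ.injective.mem_periodicPts x)]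

theorem minimalPeriod_permCongr (e : α ≃ β) (σ : Perm α) (x : α) :
    minimalPeriod (e.permCongr σ) (e x) = minimalPeriod σ x := by
  refine minimalPeriod_eq_of_iterate e.injective fun j ↦ ?_
  induction j with
  | zero => rfl
  | succ j ih => simp [iterate_succ_apply', ih]

theorem sameCycle_permCongr (e : α ≃ β) (σ : Perm α) (x y : α) :
    (e.permCongr σ).SameCycle (e x) (e y) ↔ σ.SameCycle x y := by
  have h (k : ℤ) : (e.permCongr σ ^ k) (e x) = e ((σ ^ k) x) := by
    have := map_zpow e.permCongrHom σ k
    rw [show e.permCongr σ = e.permCongrHom σ from rfl, ← this]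
    simp
  simp [Perm.SameCycle, h]

variable {σ : Perm (Option α)} {τ : Perm α} {a : α}

theorem iterate_some_of_ne (hs : ∀ y, τ y ≠ a → σ (some y) = some (τ y)) {y : α} {j : ℕ}
    (h : ∀ i < j, τ^[i + 1] y ≠ a) : σ^[j] (some y) = some (τ^[j] y) := by
  induction j with
  | zero => rfl
  | succ j ih =>
    rw [iterate_succ_apply', ih fun i hi ↦ h i (hi.trans j.lt_succ_self), hs, iterate_succ_apply']
    rw [← iterate_succ_apply' τ]
    exact h j j.lt_succ_self

theorem iterate_none_succ (hn : σ none = some a) (hs : ∀ y, τ y ≠ a → σ (some y) = some (τ y))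
    {j : ℕ} (h : j < minimalPeriod τ a) : σ^[j + 1] none = some (τ^[j] a) := by
  rw [iterate_succ_apply, hn]
  refine iterate_some_of_ne hs fun i hi ↦ ?_
  exact not_isPeriodicPt_of_pos_of_lt_minimalPeriod i.succ_ne_zero (by omega)

theorem minimalPeriod_none [Finite α] (hn : σ none = some a)
    (hs : ∀ y, τ y ≠ a → σ (some y) = some (τ y)) (hs' : ∀ y, τ y = a → σ (some y) = none) :
    minimalPeriod σ none = minimalPeriod τ a + 1 := by
  have hpos := τ.minimalPeriod_pos a
  refine le_antisymm (IsPeriodicPt.minimalPeriod_le (by omega) ?_) ?_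
  · obtain ⟨k, hk⟩ : ∃ k, minimalPeriod τ a = k + 1 := ⟨_, (Nat.succ_pred hpos.ne').symm⟩
    rw [hk, IsPeriodicPt, IsFixedPt, iterate_succ_apply', iterate_none_succ hn hs (by omega), hs']
    rw [← iterate_succ_apply' τ, Nat.succ_eq_add_one, ← hk, iterate_minimalPeriod]
  · by_contra! h
    obtain ⟨k, hk⟩ : ∃ k, minimalPeriod σ none = k + 1 :=
      ⟨_, (Nat.succ_pred (σ.minimalPeriod_pos none).ne').symm⟩
    have := iterate_minimalPeriod (f := σ) (x := none)
    rw [hk, iterate_none_succ hn hs (by omega)] at this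
    simp at this

theorem iterate_some_of_not_sameCycle (hs : ∀ y, τ y ≠ a → σ (some y) = some (τ y)) {y : α}
    (h : ¬ τ.SameCycle a y) (j : ℕ) : σ^[j] (some y) = some (τ^[j] y) := by
  refine iterate_some_of_ne hs fun i _ hi ↦ h (Perm.SameCycle.symm ⟨(i + 1 : ℕ), ?_⟩)
  rwa [zpow_natCast, Perm.coe_pow]

theorem sameCycle_none_some_iff [Finite α] (hn : σ none = some a)
    (hs : ∀ y, τ y ≠ a → σ (some y) = some (τ y)) (y : α) :
    σ.SameCycle none (some y) ↔ τ.SameCycle a y := by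
  constructor
  · intro h
    by_contra hc
    obtain ⟨i, hi⟩ := h.symm.exists_nat_pow_eq
    rw [Perm.coe_pow, iterate_some_of_not_sameCycle hs hc] at hi
    simp at hi
  · intro h
    obtain ⟨i, rfl⟩ := h.exists_nat_pow_eq
    rw [Perm.coe_pow, ← iterate_mod_minimalPeriod_eq,
      ← iterate_none_succ hn hs (Nat.mod_lt _ (τ.minimalPeriod_pos a))]
    refine ⟨(i % minimalPeriod τ a + 1 : ℕ), ?_⟩
    rw [zpow_natCast, Perm.coe_pow]

end Insertion

/-- The number of permutations of `α` all of whose cycle lengths satisfy `A`. -/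
noncomputable def permCount (A : ℕ → Prop) (α : Type*) : ℕ :=
  Nat.card {σ : Perm α // ∀ x, A (minimalPeriod σ x)}

/-- The permutation `σ` has a cycle of length `k` through `x`, and the lengths of all its other
cycles satisfy `A`. -/
def IsPointed {α : Type*} (A : ℕ → Prop) (x : α) (k : ℕ) (σ : Perm α) : Prop :=
  minimalPeriod σ x = k ∧ ∀ y, σ.SameCycle x y ∨ A (minimalPeriod σ y)

/-- The number of permutations having a cycle of length `k` through `x`, all of whose other cycle
lengths satisfy `A`. -/
noncomputable def pointedCount {α : Type*} (A : ℕ → Prop) (x : α) (k : ℕ) : ℕ :=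
  Nat.card {σ : Perm α // IsPointed A x k σ}

section Counting

variable {α β : Type*} (A : ℕ → Prop)

theorem permCount_congr (e : α ≃ β) : permCount A α = permCount A β := by
  refine Nat.card_congr (e.permCongr.subtypeEquiv fun σ ↦ ?_)
  rw [← e.forall_congr_right]
  simp only [minimalPeriod_permCongr]

theorem pointedCount_congr (e : α ≃ β) (x : α) (k : ℕ) :
    pointedCount A x k = pointedCount A (e x) k := by
  refine Nat.card_congr (e.permCongr.subtypeEquiv fun σ ↦ ?_)
  rw [IsPointed, IsPointed, ← e.forall_congr_right (q := fun y ↦ _ ∨ A (minimalPeriod _ y))]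
  simp only [minimalPeriod_permCongr, sameCycle_permCongr]

theorem pointedCount_eq [DecidableEq β] (e : α ≃ β) (x : α) (y : β) (k : ℕ) :
    pointedCount A x k = pointedCount A y k := by
  rw [pointedCount_congr A (e.trans (swap (e x) y))]
  simp

theorem card_perm_option [Fintype α] [DecidableEq α] (P : Perm (Option α) → Prop) :
    Nat.card {σ // P σ} =
      ∑ o : Option α, Nat.card {τ : Perm α // P (Perm.decomposeOption.symm (o, τ))} := by
  rw [← Nat.card_sigma]
  refine Nat.card_congr (Equiv.trans ?_ (Equiv.subtypeProdEquivSigmaSubtype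
    fun (o : Option α) (τ : Perm α) ↦ P (Perm.decomposeOption.symm (o, τ))))
  exact Perm.decomposeOption.subtypeEquiv fun σ ↦ by simp

theorem isPointed_decomposeOption_none [DecidableEq α] [Finite α] (k : ℕ) (τ : Perm α) :
    IsPointed A none k (Perm.decomposeOption.symm (none, τ)) ↔
      k = 1 ∧ ∀ x, A (minimalPeriod τ x) := by
  set σ := Perm.decomposeOption.symm (none, τ) with hσ
  have h0 : IsFixedPt σ none := by simp [IsFixedPt, hσ]
  have h1 : minimalPeriod σ none = 1 := minimalPeriod_eq_one_iff_isFixedPt.2 h0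
  have h2 (y : α) : minimalPeriod σ (some y) = minimalPeriod τ y := by
    refine minimalPeriod_eq_of_iterate (Option.some_injective α) fun j ↦ ?_
    induction j with
    | zero => rfl
    | succ j ih =>
      rw [iterate_succ_apply', iterate_succ_apply', ih]
      simp [hσ]
  have h3 (y : α) : ¬ σ.SameCycle none (some y) := by
    intro h
    obtain ⟨i, hi⟩ := h.exists_nat_pow_eq
    rw [Perm.coe_pow, h0.iterate i] at hi
    simp at hi
  simp only [IsPointed, Option.forall, h1, h2, h3, Perm.SameCycle.refl, true_or, true_and, false_or]
  rw [eq_comm]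

theorem isPointed_decomposeOption_some [DecidableEq α] [Finite α] (k : ℕ) (a : α) (τ : Perm α) :
    IsPointed A none (k + 1) (Perm.decomposeOption.symm (some a, τ)) ↔ IsPointed A a k τ := by
  set σ := Perm.decomposeOption.symm (some a, τ) with hσ
  have hn : σ none = some a := by simp [hσ]
  have hs : ∀ y, τ y ≠ a → σ (some y) = some (τ y) := fun y hy ↦ by
    simp [hσ, swap_apply_of_ne_of_ne, hy]
  have hs' : ∀ y, τ y = a → σ (some y) = none := fun y hy ↦ by simp [hσ, hy]
  have key (y : α) : (τ.SameCycle a y ∨ A (minimalPeriod σ (some y))) ↔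
      (τ.SameCycle a y ∨ A (minimalPeriod τ y)) := by
    by_cases h : τ.SameCycle a y
    · simp [h]
    · rw [minimalPeriod_eq_of_iterate (Option.some_injective α)
        (iterate_some_of_not_sameCycle hs h)]
  simp only [IsPointed, Option.forall, minimalPeriod_none hn hs hs',
    sameCycle_none_some_iff hn hs, Perm.SameCycle.refl, true_or, true_and, key,
    Nat.add_right_cancel_iff]

theorem pointedCount_zero [Finite α] (x : α) : pointedCount A x 0 = 0 := by
  have : IsEmpty {σ : Perm α // IsPointed A x 0 σ} :=
    ⟨fun σ ↦ (σ.1.minimalPeriod_pos x).ne' σ.2.1⟩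
  exact Nat.card_of_isEmpty

theorem pointedCount_none_succ [Fintype α] [DecidableEq α] (k : ℕ) :
    pointedCount A (none : Option α) (k + 1) =
      (if k = 0 then permCount A α else 0) + ∑ a : α, pointedCount A a k := by
  rw [pointedCount, card_perm_option, Fintype.sum_option]
  simp only [isPointed_decomposeOption_none, isPointed_decomposeOption_some]
  congr 1
  split_ifs with h
  · simp [h, permCount]
  · simp [h]

theorem pointedCount_fin (n k : ℕ) (hk : k ≤ n) :
    pointedCount A (0 : Fin (n + 1)) (k + 1) =
      n.descFactorial k * permCount A (Fin (n - k)) := by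
  induction k generalizing n with
  | zero =>
    rw [pointedCount_eq A (finSuccEquiv n) 0 none, pointedCount_none_succ]
    simp [pointedCount_zero]
  | succ k ih =>
    obtain ⟨n, rfl⟩ : ∃ m, n = m + 1 := ⟨n - 1, by omega⟩
    rw [pointedCount_eq A (finSuccEquiv (n + 1)) 0 none, pointedCount_none_succ]
    simp only [pointedCount_eq A (Equiv.refl (Fin (n + 1))) _ 0, ih n (by omega)]
    rw [Nat.succ_descFactorial_succ]
    simp [mul_assoc]

theorem permCount_fin_succ [DecidablePred A] (n : ℕ) :
    permCount A (Fin (n + 1)) = ∑ k ∈ Finset.range (n + 1),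
      if A (k + 1) then n.descFactorial k * permCount A (Fin (n - k)) else 0 := by
  classical
  rw [permCount, Nat.card_eq_fintype_card, Fintype.card_subtype,
    Finset.card_eq_sum_card_fiberwise (f := fun σ : Perm (Fin (n + 1)) ↦ minimalPeriod σ 0 - 1)
      (t := Finset.range (n + 1))]
  · refine Finset.sum_congr rfl fun k hk ↦ ?_
    have hk : k ≤ n := by simpa [Nat.lt_succ_iff] using hk
    have hsub (σ : Perm (Fin (n + 1))) : minimalPeriod σ 0 - 1 = k ↔ minimalPeriod σ 0 = k + 1 := by
      have := σ.minimalPeriod_pos 0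
      omega
    simp only [hsub]
    split_ifs with h
    · rw [← pointedCount_fin A n k hk, pointedCount, Nat.card_eq_fintype_card,
        Fintype.card_subtype, Finset.filter_filter]
      congr 1
      refine Finset.filter_congr fun σ _ ↦ ?_
      constructor
      · exact fun hσ ↦ ⟨hσ.2, fun y ↦ Or.inr (hσ.1 y)⟩
      · refine fun hσ ↦ ⟨fun y ↦ (hσ.2 y).elim (fun hy ↦ ?_) id, hσ.1⟩
        rwa [hy.minimalPeriod_eq, hσ.1]
    · rw [Finset.card_eq_zero, Finset.filter_filter, Finset.filter_eq_empty_iff]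
      rintro σ - ⟨hσ, hk⟩
      exact h (hk ▸ hσ 0)
  · intro σ _
    have h1 := minimalPeriod_le_card (f := σ) (x := 0)
    rw [Fintype.card_fin] at h1
    simp only [Finset.coe_range, Set.mem_Iio]
    omega

end Counting

/-- The proportion of permutations of `n` points all of whose cycle lengths satisfy `A`. -/
noncomputable def permDensity (A : ℕ → Prop) (n : ℕ) : ℚ :=
  permCount A (Fin n) / n.factorial

section Density

theorem permDensity_zero (A : ℕ → Prop) : permDensity A 0 = 1 := by
  simp [permDensity, permCount]

theorem mul_permDensity (A : ℕ → Prop) [DecidablePred A] (n : ℕ) :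
    n * permDensity A n = ∑ j ∈ Finset.range n, if A (n - j) then permDensity A j else 0 := by
  cases n with
  | zero => simp
  | succ n =>
    have hf : ((n : ℚ) + 1) ≠ 0 := by positivity
    rw [← Finset.sum_range_reflect, permDensity, permCount_fin_succ, Nat.factorial_succ]
    push_cast
    rw [← mul_div_assoc, mul_div_mul_left _ _ hf, Finset.sum_div]
    refine Finset.sum_congr rfl fun k hk ↦ ?_
    have hk : k ≤ n := by simpa [Nat.lt_succ_iff] using hk
    rw [show n + 1 - (n - k) = k + 1 by omega]
    split_ifs
    · rw [permDensity, ← Nat.factorial_mul_descFactorial hk]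
      have h1 : ((n - k).factorial : ℚ) ≠ 0 := by positivity
      have h2 : (n.descFactorial k : ℚ) ≠ 0 := by
        rw [Nat.cast_ne_zero, Ne, Nat.descFactorial_eq_zero_iff_lt]
        omega
      push_cast
      field_simp
    · simp

variable {r : ℕ}

theorem sum_range_add_dvd (hr : 0 < r) (f : ℕ → ℚ) (n : ℕ) :
    (∑ j ∈ Finset.range (n + r), if r ∣ n + r - j then f j else 0) =
      (∑ j ∈ Finset.range n, if r ∣ n - j then f j else 0) + f n := by
  rw [Finset.sum_range_add]
  congr 1
  · refine Finset.sum_congr rfl fun j hj ↦ ?_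
    rw [Finset.mem_range] at hj
    simp only [show n + r - j = n - j + r by omega, Nat.dvd_add_self_right]
  · rw [Finset.sum_eq_single_of_mem 0 (Finset.mem_range.2 hr)]
    · simp
    · intro i hi hi0
      rw [Finset.mem_range] at hi
      rw [if_neg]
      exact Nat.not_dvd_of_pos_of_lt (by omega) (by omega)

theorem permDensity_dvd_add (hr : 0 < r) (n : ℕ) :
    ((n : ℚ) + r) * permDensity (r ∣ ·) (n + r) = (n + 1) * permDensity (r ∣ ·) n := by
  have h := mul_permDensity (r ∣ ·) (n + r)
  rw [sum_range_add_dvd hr, ← mul_permDensity (r ∣ ·) n] at h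
  push_cast at h
  linear_combination h

theorem permDensity_dvd_of_not_dvd {n : ℕ} (hn : ¬ r ∣ n) : permDensity (r ∣ ·) n = 0 := by
  induction n using Nat.strong_induction_on with
  | _ n ih =>
    have h := mul_permDensity (r ∣ ·) n
    rw [Finset.sum_eq_zero] at h
    · have hn0 : (n : ℚ) ≠ 0 := by
        rintro h0
        simp [Nat.cast_eq_zero.1 h0] at hn
      exact (mul_eq_zero.1 h).resolve_left hn0
    · intro j hj
      rw [Finset.mem_range] at hj
      split_ifs with hd
      · refine ih j hj fun hj' ↦ hn ?_
        simpa [hj.le] using Nat.dvd_add hd hj'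
      · rfl

theorem mul_permDensity_not_dvd (r n : ℕ) :
    n * permDensity (¬ r ∣ ·) n = ∑ j ∈ Finset.range n, permDensity (¬ r ∣ ·) j -
      ∑ j ∈ Finset.range n, if r ∣ n - j then permDensity (¬ r ∣ ·) j else 0 := by
  rw [mul_permDensity, ← Finset.sum_sub_distrib]
  refine Finset.sum_congr rfl fun j _ ↦ ?_
  split_ifs <;> simp

theorem permDensity_not_dvd_add (hr : 0 < r) (n : ℕ) :
    ((n : ℚ) + r) * permDensity (¬ r ∣ ·) (n + r) = (n - 1) * permDensity (¬ r ∣ ·) n +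
      ∑ i ∈ Finset.range r, permDensity (¬ r ∣ ·) (n + i) := by
  have h := mul_permDensity_not_dvd r (n + r)
  have h0 := mul_permDensity_not_dvd r n
  rw [sum_range_add_dvd hr, Finset.sum_range_add] at h
  push_cast at h
  linear_combination h - h0

theorem permDensity_not_dvd_of_lt {s : ℕ} (hs : s < r) : permDensity (¬ r ∣ ·) s = 1 := by
  induction s using Nat.strong_induction_on with
  | _ s ih =>
    rcases s.eq_zero_or_pos with rfl | hpos
    · exact permDensity_zero _
    have h := mul_permDensity (¬ r ∣ ·) s
    rw [Finset.sum_congr rfl (g := fun _ ↦ (1 : ℚ))] at h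
    · have hs0 : (s : ℚ) ≠ 0 := by positivity
      simpa [hs0] using h
    · intro j hj
      rw [Finset.mem_range] at hj
      rw [if_pos (Nat.not_dvd_of_pos_of_lt (by omega) (by omega)), ih j hj (by omega)]

theorem permDensity_not_dvd_mul_succ (hr : 0 < r) (m : ℕ)
    (h : ∀ s < r, permDensity (¬ r ∣ ·) (r * m + s) = permDensity (¬ r ∣ ·) (r * m)) :
    ((r * m : ℕ) + (r : ℚ)) * permDensity (¬ r ∣ ·) (r * (m + 1)) =
      ((r * m : ℕ) + r - 1) * permDensity (¬ r ∣ ·) (r * m) := by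
  have h1 := permDensity_not_dvd_add hr (r * m)
  rw [Finset.sum_congr rfl fun i hi ↦ h i (Finset.mem_range.1 hi)] at h1
  simp only [Finset.sum_const, Finset.card_range, nsmul_eq_mul] at h1
  rw [mul_add_one]
  linear_combination h1

theorem permDensity_not_dvd_mul_add (m : ℕ) {s : ℕ} (hs : s < r) :
    permDensity (¬ r ∣ ·) (r * m + s) = permDensity (¬ r ∣ ·) (r * m) := by
  have hr : 0 < r := by omega
  induction m generalizing s with
  | zero => rw [mul_zero, zero_add, permDensity_not_dvd_of_lt hs, permDensity_zero]
  | succ m ihm =>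
    induction s with
    | zero => rfl
    | succ s ihs =>
      rw [← ihs (by omega)]
      have h0 := permDensity_not_dvd_add hr (r * m + s)
      have h1 := permDensity_not_dvd_add hr (r * m + s + 1)
      have hsum := Finset.sum_range_succ (fun i ↦ permDensity (¬ r ∣ ·) (r * m + s + i)) r
      rw [Finset.sum_range_succ'] at hsum
      have hstep : permDensity (¬ r ∣ ·) (r * m + s + 1) = permDensity (¬ r ∣ ·) (r * m + s) := by
        rw [add_assoc, ihm hs, ihm (by omega)]
      have hpos : ((r * m + s : ℕ) + (r : ℚ) + 1) ≠ 0 := by positivity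
      rw [show r * (m + 1) + (s + 1) = r * m + s + 1 + r by ring,
        show r * (m + 1) + s = r * m + s + r by ring]
      refine mul_left_cancel₀ hpos ?_
      have hshift : ∑ i ∈ Finset.range r, permDensity (¬ r ∣ ·) (r * m + s + 1 + i) =
          ∑ i ∈ Finset.range r, permDensity (¬ r ∣ ·) (r * m + s + (i + 1)) :=
        Finset.sum_congr rfl fun i _ ↦ by rw [add_assoc, add_comm 1 i]
      rw [hshift] at h1
      rw [add_zero] at hsum
      push_cast at h0 h1 ⊢
      linear_combination h1 - h0 + hsum + (r * m + s : ℚ) * hstep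

theorem permDensity_not_dvd_mul_pos (hr : 2 ≤ r) (m : ℕ) :
    0 < permDensity (¬ r ∣ ·) (r * m) := by
  have hr0 : 0 < r := by omega
  have hr' : (2 : ℚ) ≤ r := by exact_mod_cast hr
  induction m with
  | zero => simp [permDensity_zero]
  | succ m ih =>
    have h := permDensity_not_dvd_mul_succ hr0 m fun s hs ↦ permDensity_not_dvd_mul_add m hs
    have hm : (0 : ℚ) ≤ (r * m : ℕ) := by positivity
    refine pos_of_mul_pos_right (a := (r * m : ℕ) + (r : ℚ)) ?_ (by positivity)
    rw [h]
    exact mul_pos (by linarith) ih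

theorem permDensity_dvd_le (hr : 2 ≤ r) (m : ℕ) :
    permDensity (r ∣ ·) (r * m) ≤ permDensity (¬ r ∣ ·) (r * m) := by
  have hr0 : 0 < r := by omega
  have hr' : (2 : ℚ) ≤ r := by exact_mod_cast hr
  induction m with
  | zero => simp [permDensity_zero]
  | succ m ih =>
    have h := permDensity_not_dvd_mul_succ hr0 m fun s hs ↦ permDensity_not_dvd_mul_add m hs
    have h' := permDensity_dvd_add hr0 (r * m)
    have hm : (0 : ℚ) ≤ (r * m : ℕ) := by positivity
    have hpos := permDensity_not_dvd_mul_pos hr m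
    rw [← mul_add_one] at h'
    refine le_of_mul_le_mul_left (a := (r * m : ℕ) + (r : ℚ)) ?_ (by positivity)
    rw [h, h']
    exact mul_le_mul (by linarith) ih (by unfold permDensity; positivity) (by linarith)

theorem permDensity_dvd_lt (hr : 3 ≤ r) (m : ℕ) :
    permDensity (r ∣ ·) (r * (m + 1)) < permDensity (¬ r ∣ ·) (r * (m + 1)) := by
  have hr0 : 0 < r := by omega
  have hr' : (3 : ℚ) ≤ r := by exact_mod_cast hr
  have h := permDensity_not_dvd_mul_succ hr0 m fun s hs ↦ permDensity_not_dvd_mul_add m hs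
  have h' := permDensity_dvd_add hr0 (r * m)
  have hm : (0 : ℚ) ≤ (r * m : ℕ) := by positivity
  have hpos := permDensity_not_dvd_mul_pos (by omega : 2 ≤ r) m
  rw [← mul_add_one] at h'
  refine lt_of_mul_lt_mul_left (a := (r * m : ℕ) + (r : ℚ)) ?_ (by positivity)
  rw [h, h']
  exact (mul_le_mul_of_nonneg_left (permDensity_dvd_le (by omega) m) (by linarith)).trans_lt
    (mul_lt_mul_of_pos_right (by linarith) hpos)

theorem permDensity_two_dvd_eq (m : ℕ) :
    permDensity (2 ∣ ·) (2 * m) = permDensity (¬ 2 ∣ ·) (2 * m) := by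
  induction m with
  | zero => simp [permDensity_zero]
  | succ m ih =>
    have h := permDensity_not_dvd_mul_succ two_pos m fun s hs ↦ permDensity_not_dvd_mul_add m hs
    have h' := permDensity_dvd_add two_pos (2 * m)
    have hm : (0 : ℚ) ≤ (2 * m : ℕ) := by positivity
    rw [← mul_add_one, ih] at h'
    refine mul_left_cancel₀ (a := (2 * m : ℕ) + ((2 : ℕ) : ℚ)) (by positivity) ?_
    rw [h, h']
    push_cast
    ring

end Density

/-- `|Cyc_r(n)| ≤ |Reg_r(n)|`, with equality iff `r = 2` and `n` even. -/
theorem stmt10 (r n : ℕ) (hr : 2 ≤ r) (hn : 1 ≤ n) :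
    Nat.card {σ : Equiv.Perm (Fin n) // ∀ x, r ∣ Function.minimalPeriod ⇑σ x} ≤
      Nat.card {σ : Equiv.Perm (Fin n) // ∀ x, ¬ r ∣ Function.minimalPeriod ⇑σ x} ∧
    (Nat.card {σ : Equiv.Perm (Fin n) // ∀ x, r ∣ Function.minimalPeriod ⇑σ x} =
        Nat.card {σ : Equiv.Perm (Fin n) // ∀ x, ¬ r ∣ Function.minimalPeriod ⇑σ x} ↔
      r = 2 ∧ Even n) := by
  change permCount (r ∣ ·) (Fin n) ≤ permCount (¬ r ∣ ·) (Fin n) ∧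
    (permCount (r ∣ ·) (Fin n) = permCount (¬ r ∣ ·) (Fin n) ↔ r = 2 ∧ Even n)
  have hf : (0 : ℚ) < n.factorial := by positivity
  have lt_of_density (h : permDensity (r ∣ ·) n < permDensity (¬ r ∣ ·) n) :
      permCount (r ∣ ·) (Fin n) < permCount (¬ r ∣ ·) (Fin n) := by
    rwa [permDensity, permDensity, div_lt_div_iff_of_pos_right hf, Nat.cast_lt] at h
  by_cases hd : r ∣ n
  · obtain ⟨m, rfl⟩ := hd
    obtain ⟨m, rfl⟩ : ∃ k, m = k + 1 := ⟨m - 1, by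
      have : m ≠ 0 := by rintro rfl; simp at hn
      omega⟩
    rcases hr.eq_or_lt with rfl | hr
    · have h := permDensity_two_dvd_eq (m + 1)
      rw [permDensity, permDensity, div_left_inj' hf.ne', Nat.cast_inj] at h
      exact ⟨h.le, by simp [h]⟩
    · have h := lt_of_density (permDensity_dvd_lt hr m)
      exact ⟨h.le, iff_of_false h.ne fun h2 ↦ hr.ne' h2.1⟩
  · have h := lt_of_density (by
      rw [permDensity_dvd_of_not_dvd hd, ← Nat.div_add_mod n r,
        permDensity_not_dvd_mul_add _ (Nat.mod_lt _ (by omega))]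
      exact permDensity_not_dvd_mul_pos hr _)
    refine ⟨h.le, iff_of_false h.ne ?_⟩
    rintro ⟨rfl, h2⟩
    exact hd h2.two_dvd
end

section
/- For all r ≥ 2 and m ≥ 1, |Cyc_{r^2}(m r^2)| < |Reg_r(m r^2)|: the number of permutations of {1,...,mr^2} all of whose cycle lengths are divisible by r^2 is strictly less than the number of permutations of {1,...,mr^2} none of whose cycle lengths is divisible by r. -/
/-- The order `∏ i, i ^ mᵢ * mᵢ!` of the centralizer of a permutation with cycle lengths `s`, where
`mᵢ` is the multiplicity of `i` in `s`. -/
def Multiset.centralizerCard (s : Multiset ℕ) : ℕ :=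
  s.prod * ∏ i ∈ s.toFinset, (s.count i).factorial

theorem Multiset.centralizerCard_eq_prod_of_subset {s : Multiset ℕ} {t : Finset ℕ}
    (h : s.toFinset ⊆ t) :
    s.centralizerCard = s.prod * ∏ i ∈ t, (s.count i).factorial := by
  unfold Multiset.centralizerCard
  congr 1
  refine Finset.prod_subset h fun i _ hi ↦ ?_
  rw [Multiset.count_eq_zero_of_notMem (by simpa using hi), Nat.factorial_zero]

theorem Multiset.centralizerCard_cons (a : ℕ) (s : Multiset ℕ) :
    (a ::ₘ s).centralizerCard = a * (a ::ₘ s).count a * s.centralizerCard := by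
  have hs : s.toFinset ⊆ (a ::ₘ s).toFinset := by simp
  rw [Multiset.centralizerCard_eq_prod_of_subset hs,
    Multiset.centralizerCard_eq_prod_of_subset subset_rfl]
  have ha : a ∈ (a ::ₘ s).toFinset := by simp
  rw [← Finset.mul_prod_erase _ _ ha, ← Finset.mul_prod_erase _ _ ha]
  have h : ∏ i ∈ (a ::ₘ s).toFinset.erase a, ((a ::ₘ s).count i).factorial =
      ∏ i ∈ (a ::ₘ s).toFinset.erase a, (s.count i).factorial :=
    Finset.prod_congr rfl fun i hi ↦ by
      rw [Multiset.count_cons_of_ne (Finset.ne_of_mem_erase hi)]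
  rw [h, Multiset.count_cons_self, Nat.factorial_succ, Multiset.prod_cons]
  ring

theorem Multiset.centralizerCard_add_replicate_one {s : Multiset ℕ} (hs : 1 ∉ s) (n : ℕ) :
    (s + Multiset.replicate n 1).centralizerCard = n.factorial * s.centralizerCard := by
  induction n with
  | zero => simp
  | succ n ih =>
    rw [Multiset.replicate_succ, Multiset.add_cons, Multiset.centralizerCard_cons, ih,
      Multiset.count_cons_self, Multiset.count_add, Multiset.count_eq_zero_of_notMem hs,
      Multiset.count_replicate_self, Nat.factorial_succ]
    ring

theorem Multiset.centralizerCard_pos {s : Multiset ℕ} (hs : ∀ i ∈ s, 0 < i) :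
    0 < s.centralizerCard :=
  Nat.mul_pos (Multiset.prod_pos hs) (Finset.prod_pos fun _ _ ↦ Nat.factorial_pos _)

namespace Equiv.Perm

variable {α : Type*} [Fintype α] [DecidableEq α]

theorem minimalPeriod_eq_orderOf_cycleOf (σ : Perm α) (x : α) :
    Function.minimalPeriod σ x = orderOf (σ.cycleOf x) := by
  refine Nat.dvd_right_iff_eq.mp fun n ↦ ?_
  rw [orderOf_dvd_iff_pow_eq_one, ← Function.isPeriodicPt_iff_minimalPeriod_dvd,
    Function.IsPeriodicPt, Function.IsFixedPt, iterate_eq_pow, ← cycleOf_pow_apply_self]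
  by_cases hx : σ x = x
  · rw [(cycleOf_eq_one_iff σ).mpr hx]
    simp
  · exact ((isCycle_cycleOf σ hx).pow_eq_one_iff' (by rwa [cycleOf_apply_self])).symm

theorem mem_parts_partition_iff (σ : Perm α) (l : ℕ) :
    l ∈ σ.partition.parts ↔ ∃ x, Function.minimalPeriod σ x = l := by
  simp_rw [minimalPeriod_eq_orderOf_cycleOf]
  rw [parts_partition, Multiset.mem_add, Multiset.mem_replicate]
  constructor
  · rintro (h | ⟨h, rfl⟩)
    · rw [cycleType_def, Multiset.mem_map] at h
      obtain ⟨c, hc, rfl⟩ := h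
      have hcyc := (mem_cycleFactorsFinset_iff.mp hc).1
      obtain ⟨x, hx⟩ := hcyc.nonempty_support
      exact ⟨x, by rw [← cycle_is_cycleOf hx hc, hcyc.orderOf]; rfl⟩
    · have : ∃ x, x ∉ σ.support := by
        by_contra! hall
        rw [Finset.eq_univ_iff_forall.mpr hall] at h
        simp at h
      obtain ⟨x, hx⟩ := this
      exact ⟨x, by rw [(cycleOf_eq_one_iff σ).mpr (notMem_support.mp hx), orderOf_one]⟩
  · rintro ⟨x, rfl⟩
    by_cases hx : σ x = x
    · right
      rw [(cycleOf_eq_one_iff σ).mpr hx, orderOf_one]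
      refine ⟨?_, rfl⟩
      have := Finset.card_lt_univ_of_notMem (notMem_support.mpr hx)
      lia
    · left
      rw [cycleType_def, Multiset.mem_map]
      exact ⟨σ.cycleOf x, cycleOf_mem_cycleFactorsFinset_iff.mpr (mem_support.mpr hx),
        (isCycle_cycleOf σ hx).orderOf.symm⟩

theorem card_partition_eq_mul_centralizerCard (p : (Fintype.card α).Partition) :
    ({σ : Perm α | σ.partition = p} : Finset (Perm α)).card * p.parts.centralizerCard =
      (Fintype.card α).factorial := by
  set m := p.parts.filter (2 ≤ ·) with hm
  have hp : p.parts = m + Multiset.replicate (p.parts.count 1) 1 := by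
    rw [← Multiset.filter_eq', hm]
    conv_lhs => rw [← Multiset.filter_add_not (2 ≤ ·) p.parts]
    congr 1
    refine Multiset.filter_congr fun i hi ↦ ?_
    have := p.parts_pos hi
    lia
  have hsum : m.sum + p.parts.count 1 = Fintype.card α := by
    conv_rhs => rw [← p.parts_sum, hp]
    simp
  have hone : 1 ∉ m := by simp [hm]
  have hfilter : ({σ : Perm α | σ.partition = p} : Finset (Perm α)) =
      ({σ : Perm α | σ.cycleType = m} : Finset (Perm α)) := by
    refine Finset.filter_congr fun σ _ ↦ ⟨?_, fun h ↦ ?_⟩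
    · rintro rfl
      rw [hm, filter_parts_partition_eq_cycleType]
    · rw [Nat.Partition.ext_iff, parts_partition, hp, h, ← sum_cycleType, h]
      congr 2
      lia
  have key := card_of_cycleType_mul_eq α m
  rw [if_pos ⟨by lia, fun a ha ↦ (Multiset.mem_filter.mp ha).2⟩] at key
  rw [hfilter, ← key, hp, Multiset.centralizerCard_add_replicate_one hone,
    show Fintype.card α - m.sum = p.parts.count 1 by lia, Multiset.centralizerCard, mul_assoc]

end Equiv.Perm

/-- The probability that all cycle lengths of a random permutation of `n` points satisfy `P`. -/
noncomputable def cycleProb (P : ℕ → Prop) [DecidablePred P] (n : ℕ) : ℚ :=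
  ∑ p ∈ Nat.Partition.restricted n P, (p.parts.centralizerCard : ℚ)⁻¹

theorem Equiv.Perm.card_forall_minimalPeriod (α : Type*) [Fintype α] (P : ℕ → Prop)
    [DecidablePred P] :
    (Nat.card {σ : Equiv.Perm α // ∀ x, P (Function.minimalPeriod ⇑σ x)} : ℚ) =
      (Fintype.card α).factorial * cycleProb P (Fintype.card α) := by
  classical
  rw [Nat.card_eq_fintype_card, Fintype.card_subtype, cycleProb, Finset.mul_sum,
    Finset.card_eq_sum_card_fiberwise (f := Equiv.Perm.partition)
      (t := Nat.Partition.restricted (Fintype.card α) P)]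
  · rw [Nat.cast_sum]
    refine Finset.sum_congr rfl fun p hp ↦ ?_
    have hpos : (p.parts.centralizerCard : ℚ) ≠ 0 := by
      exact_mod_cast (Multiset.centralizerCard_pos fun _ hi ↦ p.parts_pos hi).ne'
    rw [eq_mul_inv_iff_mul_eq₀ hpos]
    rw [← Equiv.Perm.card_partition_eq_mul_centralizerCard p, Nat.cast_mul]
    congr 3
    ext σ
    simp only [Finset.mem_filter, Finset.mem_univ, true_and, and_iff_right_iff_imp]
    rintro rfl x
    simp only [Nat.Partition.restricted, Finset.mem_filter, Finset.mem_univ, true_and] at hp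
    exact hp _ ((Equiv.Perm.mem_parts_partition_iff σ _).mpr ⟨x, rfl⟩)
  · intro σ hσ
    simp only [Finset.coe_filter, Finset.mem_univ, true_and, Set.mem_ofPred_eq] at hσ
    simp only [Nat.Partition.restricted, Finset.coe_filter, Finset.mem_univ, true_and,
      Set.mem_ofPred_eq]
    intro l hl
    obtain ⟨x, rfl⟩ := (Equiv.Perm.mem_parts_partition_iff σ l).mp hl
    exact hσ x

section Recurrence

variable (P : ℕ → Prop) [DecidablePred P]

theorem cycleProb_zero : cycleProb P 0 = 1 := by
  have : Nat.Partition.restricted 0 P = Finset.univ := by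
    ext p
    simp [Nat.Partition.restricted]
  rw [cycleProb, this, Fintype.sum_unique]
  simp [Multiset.centralizerCard]

theorem sum_restricted_centralizerCard_mul_count {n l : ℕ} (hl : 1 ≤ l) (hln : l ≤ n) :
    ∑ p ∈ Nat.Partition.restricted n P, (p.parts.centralizerCard : ℚ)⁻¹ * (p.parts.count l * l) =
      if P l then cycleProb P (n - l) else 0 := by
  have hvanish : ∀ p : n.Partition, l ∉ p.parts →
      (p.parts.centralizerCard : ℚ)⁻¹ * (p.parts.count l * l) = 0 := fun p hp ↦ by
    simp [Multiset.count_eq_zero_of_notMem hp]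
  split_ifs with hPl
  · rw [cycleProb, ← Finset.sum_filter_of_ne (p := fun p : n.Partition ↦ l ∈ p.parts)
      fun p _ ↦ not_imp_comm.mp (hvanish p)]
    symm
    refine Finset.sum_bij
      (fun q _ ↦ ((Nat.Partition.partitionWithPartEquiv hl hln).symm q).1) ?_ ?_ ?_ ?_
    · intro q hq
      simp only [Nat.Partition.restricted, Finset.mem_filter, Finset.mem_univ, true_and] at hq ⊢
      simpa using ⟨hPl, hq⟩
    · intro q _ q' _ h
      exact (Nat.Partition.partitionWithPartEquiv hl hln).symm.injective (Subtype.ext h)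
    · intro p hp
      simp only [Nat.Partition.restricted, Finset.mem_filter, Finset.mem_univ, true_and] at hp
      refine ⟨Nat.Partition.partitionWithPartEquiv hl hln ⟨p, hp.2⟩, ?_, by simp⟩
      simp only [Nat.Partition.restricted, Finset.mem_filter, Finset.mem_univ, true_and,
        Nat.Partition.partitionWithPartEquiv_apply_parts]
      exact fun i hi ↦ hp.1 i (Multiset.mem_of_mem_erase hi)
    · intro q _
      rw [Nat.Partition.partitionWithPartEquiv_symm_apply_parts, Multiset.centralizerCard_cons]
      have hq : (q.parts.centralizerCard : ℚ) ≠ 0 := by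
        exact_mod_cast (Multiset.centralizerCard_pos fun _ hi ↦ q.parts_pos hi).ne'
      have hl' : (l : ℚ) ≠ 0 := by positivity
      have hc : ((l ::ₘ q.parts).count l : ℚ) ≠ 0 := by
        rw [Multiset.count_cons_self]
        positivity
      push_cast
      field_simp
  · refine Finset.sum_eq_zero fun p hp ↦ hvanish p fun hlp ↦ hPl ?_
    simp only [Nat.Partition.restricted, Finset.mem_filter, Finset.mem_univ, true_and] at hp
    exact hp l hlp

theorem mul_cycleProb (n : ℕ) :
    n * cycleProb P n = ∑ j ∈ Finset.range n, if P (n - j) then cycleProb P j else 0 := by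
  have hsum : ∀ p : n.Partition, (n : ℚ) = ∑ l ∈ Finset.Icc 1 n, (p.parts.count l * l : ℚ) := by
    intro p
    conv_lhs => rw [← p.parts_sum, Finset.sum_multiset_count_of_subset p.parts (Finset.Icc 1 n)
      fun i hi ↦ Finset.mem_Icc.mpr ⟨p.parts_pos (Multiset.mem_toFinset.mp hi),
        p.le_of_mem_parts (Multiset.mem_toFinset.mp hi)⟩]
    push_cast [smul_eq_mul]
    rfl
  calc
    n * cycleProb P n = ∑ p ∈ Nat.Partition.restricted n P, ∑ l ∈ Finset.Icc 1 n,
        (p.parts.centralizerCard : ℚ)⁻¹ * (p.parts.count l * l) := by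
      rw [cycleProb, Finset.mul_sum]
      refine Finset.sum_congr rfl fun p _ ↦ ?_
      rw [← Finset.mul_sum, ← hsum p, mul_comm]
    _ = ∑ l ∈ Finset.Icc 1 n, if P l then cycleProb P (n - l) else 0 := by
      rw [Finset.sum_comm]
      refine Finset.sum_congr rfl fun l hl ↦ ?_
      rw [Finset.mem_Icc] at hl
      exact sum_restricted_centralizerCard_mul_count P hl.1 hl.2
    _ = _ := by
      refine Finset.sum_bij' (fun l _ ↦ n - l) (fun j _ ↦ n - j) ?_ ?_ ?_ ?_ ?_
      · simp; lia
      · simp; lia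
      · simp; lia
      · simp; lia
      · intro l hl
        rw [Finset.mem_Icc] at hl
        rw [Nat.sub_sub_self hl.2]

/-- For a condition that is periodic in the cycle length, subtracting the recurrences at `n + k`
and `n` leaves a sum of bounded length. -/
theorem add_mul_cycleProb_add {k : ℕ} (hP : ∀ l, P (l + k) ↔ P l) (n : ℕ) :
    ((n + k : ℕ) : ℚ) * cycleProb P (n + k) = n * cycleProb P n +
      ∑ i ∈ Finset.range k, if P (k - i) then cycleProb P (n + i) else 0 := by
  rw [mul_cycleProb, mul_cycleProb, Finset.sum_range_add]
  congr 1
  · refine Finset.sum_congr rfl fun j hj ↦ ?_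
    rw [Finset.mem_range] at hj
    rw [show n + k - j = n - j + k by lia]
    simp only [hP]
  · simp [Nat.add_sub_add_left]

end Recurrence

theorem cycleProb_dvd_add {k : ℕ} (hk : 0 < k) (n : ℕ) :
    ((n + k : ℕ) : ℚ) * cycleProb (k ∣ ·) (n + k) = (n + 1) * cycleProb (k ∣ ·) n := by
  rw [add_mul_cycleProb_add _ (by simp), Finset.sum_eq_single 0]
  · simp
    ring
  · intro i hi hi0
    rw [Finset.mem_range] at hi
    exact if_neg (Nat.not_dvd_of_pos_of_lt (by lia) (by lia))
  · simp [hk.ne']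

section Regular

variable {r : ℕ}

theorem cycleProb_not_dvd_add (hr : 0 < r) (n : ℕ) :
    ((n + r : ℕ) : ℚ) * cycleProb (¬ r ∣ ·) (n + r) = n * cycleProb (¬ r ∣ ·) n +
      ∑ i ∈ Finset.range (r - 1), cycleProb (¬ r ∣ ·) (n + 1 + i) := by
  rw [add_mul_cycleProb_add _ (by simp)]
  obtain ⟨s, rfl⟩ : ∃ s, r = s + 1 := ⟨r - 1, by lia⟩
  rw [Finset.sum_range_succ']
  simp only [Nat.sub_zero, dvd_refl, not_true, if_false, add_zero, Nat.add_sub_cancel]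
  congr 1
  refine Finset.sum_congr rfl fun i hi ↦ ?_
  rw [Finset.mem_range] at hi
  rw [if_pos (Nat.not_dvd_of_pos_of_lt (by lia) (by lia)), add_assoc, add_comm 1 i]

theorem cycleProb_not_dvd_of_lt {n : ℕ} (hn : n < r) : cycleProb (¬ r ∣ ·) n = 1 := by
  induction n using Nat.strong_induction_on with
  | _ n ih =>
    rcases Nat.eq_zero_or_pos n with rfl | hpos
    · exact cycleProb_zero _
    · have h := mul_cycleProb (¬ r ∣ ·) n
      rw [Finset.sum_congr rfl (g := fun _ ↦ (1 : ℚ))] at h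
      · have : (n : ℚ) ≠ 0 := by positivity
        simpa [this] using h
      · intro j hj
        rw [Finset.mem_range] at hj
        rw [if_pos (Nat.not_dvd_of_pos_of_lt (by lia) (by lia)), ih j hj (by lia)]

theorem cycleProb_not_dvd_sub_sub (hr : 0 < r) (n : ℕ) :
    ((n + r + 1 : ℕ) : ℚ) *
        (cycleProb (¬ r ∣ ·) (n + r + 1) - cycleProb (¬ r ∣ ·) (n + r)) =
      n * (cycleProb (¬ r ∣ ·) (n + 1) - cycleProb (¬ r ∣ ·) n) := by
  have h₀ := cycleProb_not_dvd_add hr n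
  have h₁ := cycleProb_not_dvd_add hr (n + 1)
  have h₂ := Finset.sum_range_succ (fun i ↦ cycleProb (¬ r ∣ ·) (n + 1 + i)) (r - 1)
  rw [Finset.sum_range_succ', show n + 1 + (r - 1) = n + r by lia] at h₂
  simp only [add_zero] at h₂
  rw [Finset.sum_congr rfl fun i _ ↦ congrArg (cycleProb (¬ r ∣ ·))
    (show n + 1 + (i + 1) = n + 1 + 1 + i by lia)] at h₂
  rw [show n + 1 + r = n + r + 1 by lia] at h₁
  push_cast at h₀ h₁ ⊢
  linarith

theorem cycleProb_not_dvd_mul_add {q i : ℕ} (hi : i < r) :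
    cycleProb (¬ r ∣ ·) (r * q + i) = cycleProb (¬ r ∣ ·) (r * q) := by
  have hstep : ∀ q i, i + 1 < r →
      cycleProb (¬ r ∣ ·) (r * q + i + 1) - cycleProb (¬ r ∣ ·) (r * q + i) = 0 := by
    intro q
    induction q with
    | zero =>
      intro i hi
      rw [cycleProb_not_dvd_of_lt (by lia), cycleProb_not_dvd_of_lt (by lia), sub_self]
    | succ q ih =>
      intro i hi
      have h := cycleProb_not_dvd_sub_sub (r := r) (by lia) (r * q + i)
      rw [ih i hi, mul_zero, show r * q + i + r = r * (q + 1) + i by ring] at h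
      exact (mul_eq_zero.mp h).resolve_left (by positivity)
  induction i with
  | zero => rfl
  | succ i ih => rw [← ih (by lia), ← sub_eq_zero, ← add_assoc, hstep q i hi]

theorem cycleProb_not_dvd_mul_succ (hr : 0 < r) (q : ℕ) :
    cycleProb (¬ r ∣ ·) (r * (q + 1)) =
      (1 - 1 / (r * (q + 1))) * cycleProb (¬ r ∣ ·) (r * q) := by
  have h := cycleProb_not_dvd_add hr (r * q)
  rw [Finset.sum_congr rfl (g := fun _ ↦ cycleProb (¬ r ∣ ·) (r * q))] at h
  · rw [Finset.sum_const, Finset.card_range, nsmul_eq_mul, Nat.cast_sub hr,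
      show r * q + r = r * (q + 1) by ring] at h
    push_cast at h
    have : (r : ℚ) ≠ 0 := by positivity
    have : (q + 1 : ℚ) ≠ 0 := by positivity
    field_simp
    linarith
  · intro i hi
    rw [Finset.mem_range] at hi
    rw [add_assoc, cycleProb_not_dvd_mul_add (by lia)]

theorem cycleProb_nonneg (P : ℕ → Prop) [DecidablePred P] (n : ℕ) : 0 ≤ cycleProb P n :=
  Finset.sum_nonneg fun _ _ ↦ by positivity

theorem le_cycleProb_not_dvd_mul_add (hr : 0 < r) (q t : ℕ) :
    (1 - t / (r * (q + 1))) * cycleProb (¬ r ∣ ·) (r * q) ≤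
      cycleProb (¬ r ∣ ·) (r * (q + t)) := by
  induction t with
  | zero => simp
  | succ t ih =>
    rw [← add_assoc, cycleProb_not_dvd_mul_succ hr]
    have hr' : (1 : ℚ) ≤ r := by exact_mod_cast hr
    set a : ℚ := 1 / (r * (q + 1)) with ha
    have ha0 : 0 ≤ a := by positivity
    have ha1 : a ≤ 1 := by
      rw [ha, div_le_one (by positivity)]
      nlinarith [(Nat.cast_nonneg q : (0 : ℚ) ≤ q)]
    have hle : 1 / (r * (((q + t : ℕ) : ℚ) + 1)) ≤ a := by
      rw [ha]
      push_cast
      gcongr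
      linarith [(Nat.cast_nonneg t : (0 : ℚ) ≤ t)]
    have e : ∀ s : ℚ, s / (r * (q + 1)) = s * a := fun s ↦ by rw [ha]; ring
    rw [e] at ih ⊢
    have hc := cycleProb_nonneg (¬ r ∣ ·) (r * q)
    have hc' := cycleProb_nonneg (¬ r ∣ ·) (r * (q + t))
    calc
      (1 - ((t + 1 : ℕ) : ℚ) * a) * cycleProb (¬ r ∣ ·) (r * q)
          ≤ (1 - a) * ((1 - t * a) * cycleProb (¬ r ∣ ·) (r * q)) := by
        rw [← mul_assoc]
        refine mul_le_mul_of_nonneg_right ?_ hc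
        push_cast
        nlinarith [mul_nonneg (Nat.cast_nonneg t : (0 : ℚ) ≤ t) (mul_nonneg ha0 ha0)]
      _ ≤ (1 - a) * cycleProb (¬ r ∣ ·) (r * (q + t)) :=
        mul_le_mul_of_nonneg_left ih (by linarith)
      _ ≤ _ := mul_le_mul_of_nonneg_right (by linarith) hc'

end Regular

theorem cycleProb_sq_dvd_lt_cycleProb_not_dvd {r m : ℕ} (hr : 2 ≤ r) (hm : 1 ≤ m) :
    cycleProb (r ^ 2 ∣ ·) (m * r ^ 2) < cycleProb (¬ r ∣ ·) (m * r ^ 2) := by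
  have hr' : (2 : ℚ) ≤ r := by exact_mod_cast hr
  induction m, hm using Nat.le_induction with
  | base =>
    have h₁ := cycleProb_dvd_add (k := r ^ 2) (by positivity) 0
    have h₂ := cycleProb_not_dvd_mul_succ (r := r) (by lia) 0
    have h₃ := le_cycleProb_not_dvd_mul_add (r := r) (by lia) 1 (r - 1)
    rw [show r * (1 + (r - 1)) = 1 * r ^ 2 by rw [Nat.add_sub_cancel' (by lia)]; ring] at h₃
    rw [zero_add, mul_zero, cycleProb_zero] at h₂
    rw [zero_add, cycleProb_zero] at h₁
    rw [h₂, Nat.cast_sub (by lia)] at h₃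
    refine lt_of_lt_of_le ?_ h₃
    rw [one_mul]
    have h₄ : cycleProb (r ^ 2 ∣ ·) (r ^ 2) = 1 / (r : ℚ) ^ 2 := by
      rw [eq_div_iff (by positivity)]
      push_cast at h₁
      linarith
    rw [h₄, div_lt_iff₀ (by positivity)]
    push_cast
    field_simp
    nlinarith
  | succ m hm ih =>
    have hm' : (1 : ℚ) ≤ m := by exact_mod_cast hm
    have h₁ := cycleProb_dvd_add (k := r ^ 2) (by positivity) (m * r ^ 2)
    have h₂ := le_cycleProb_not_dvd_mul_add (r := r) (by lia) (m * r) r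
    rw [show r * (m * r) = m * r ^ 2 by ring, show r * (m * r + r) = (m + 1) * r ^ 2 by ring] at h₂
    rw [show m * r ^ 2 + r ^ 2 = (m + 1) * r ^ 2 by ring] at h₁
    refine lt_of_lt_of_le ?_ h₂
    have hc := cycleProb_nonneg (r ^ 2 ∣ ·) (m * r ^ 2)
    set c := cycleProb (r ^ 2 ∣ ·) (m * r ^ 2)
    set d := cycleProb (¬ r ∣ ·) (m * r ^ 2)
    have h₃ : cycleProb (r ^ 2 ∣ ·) ((m + 1) * r ^ 2) =
        (m * r ^ 2 + 1) / ((m + 1) * r ^ 2) * c := by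
      rw [div_mul_eq_mul_div, eq_div_iff (by positivity)]
      push_cast at h₁
      linarith
    have h₄ : (1 - r / (r * (((m * r : ℕ) : ℚ) + 1))) = m * r / (m * r + 1) := by
      push_cast
      field_simp
      ring
    rw [h₃, h₄]
    refine mul_lt_mul_of_le_of_lt_of_nonneg_of_pos ?_ ih hc (by positivity)
    rw [div_le_div_iff₀ (by positivity) (by positivity)]
    have h₅ : 1 ≤ (r : ℚ) * (r ^ 2 - r - 1) := by nlinarith
    nlinarith [mul_le_mul hm' h₅ zero_le_one (by positivity)]

/-- `|Cyc_{r²}(mr²)| < |Reg_r(mr²)|`. -/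
theorem stmt11 (r m : ℕ) (hr : 2 ≤ r) (hm : 1 ≤ m) :
    Nat.card {σ : Equiv.Perm (Fin (m * r ^ 2)) //
        ∀ x, r ^ 2 ∣ Function.minimalPeriod ⇑σ x} <
      Nat.card {σ : Equiv.Perm (Fin (m * r ^ 2)) //
        ∀ x, ¬ r ∣ Function.minimalPeriod ⇑σ x} := by
  have h₁ := Equiv.Perm.card_forall_minimalPeriod (Fin (m * r ^ 2)) (r ^ 2 ∣ ·)
  have h₂ := Equiv.Perm.card_forall_minimalPeriod (Fin (m * r ^ 2)) (¬ r ∣ ·)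
  rw [Fintype.card_fin] at h₁ h₂
  rw [← Nat.cast_lt (α := ℚ), h₁, h₂]
  exact mul_lt_mul_of_pos_left (cycleProb_sq_dvd_lt_cycleProb_not_dvd hr hm)
    (by exact_mod_cast Nat.factorial_pos _)
end

section
/- Let r = q^l be a prime power with r > 2. For any m ≥ 1, the number of permutations of {1,...,mqr} possessing an r-th root is strictly greater than mqr times |Cyc_{q,r}(mqr)|. -/
/-- Membership in `Cyc_{q,r}(n)`: every cycle length is a multiple of `q` and
each cycle length occurs a multiple of `r` times. -/
def CycQR (q r : ℕ) {α : Type*} [Fintype α] [DecidableEq α] (σ : Equiv.Perm α) : Prop :=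
  (∀ x, q ∣ Function.minimalPeriod ⇑σ x) ∧
    ∀ i : ℕ, r ∣ Multiset.count i σ.cycleType

namespace Equiv.Perm

lemma cycleType_permCongr {α β : Type*} [Fintype α] [DecidableEq α] [Fintype β] [DecidableEq β]
    (e : α ≃ β) (σ : Perm α) : (e.permCongr σ).cycleType = σ.cycleType := by
  rw [← cycleType_extendDomain (p := fun _ : β => True)
    (e.trans (Equiv.subtypeUnivEquiv (by simp)).symm) (g := σ)]
  congr 1

lemma cycleType_prodExtendRight {β γ : Type*} [Fintype β] [DecidableEq β] [Fintype γ]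
    [DecidableEq γ] (j : γ) (ρ : Perm β) :
    (prodExtendRight j ρ).cycleType = ρ.cycleType := by
  let f : β ≃ {x : γ × β // x.1 = j} :=
    ⟨fun b => ⟨(j, b), rfl⟩, fun x => x.1.2, fun b => rfl, by rintro ⟨⟨_, b⟩, rfl⟩; rfl⟩
  rw [← cycleType_extendDomain f (g := ρ)]
  congr 1
  ext1 ⟨i, b⟩
  by_cases h : i = j
  · subst h
    rw [prodExtendRight_apply_eq]
    exact (extendDomain_apply_image ρ f b).symm
  · rw [prodExtendRight_apply_ne _ h, extendDomain_apply_not_subtype ρ f (b := (i, b)) h]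

lemma cycleType_prodShear_ite {β γ : Type*} [Fintype β] [DecidableEq β] [Fintype γ]
    [DecidableEq γ] (ρ : Perm β) (J : Finset γ) :
    cycleType (Equiv.prodShear (Equiv.refl γ) fun j => if j ∈ J then ρ else Equiv.refl β) =
      J.card • ρ.cycleType := by
  induction J using Finset.induction_on with
  | empty =>
    simp only [Finset.card_empty, zero_nsmul, cycleType_eq_zero]
    ext1 x
    simp
  | insert j J hj ih =>
    have hmul : (Equiv.prodShear (Equiv.refl γ)
          fun i => if i ∈ insert j J then ρ else Equiv.refl β : Perm (γ × β)) =
        prodExtendRight j ρ *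
          Equiv.prodShear (Equiv.refl γ) fun i => if i ∈ J then ρ else Equiv.refl β := by
      ext1 ⟨i, b⟩
      by_cases h : i = j
      · subst h
        simp [hj, prodExtendRight_apply_eq]
      · simp [h, prodExtendRight_apply_ne]
    have hd : Disjoint (prodExtendRight j ρ)
        (Equiv.prodShear (Equiv.refl γ) fun i => if i ∈ J then ρ else Equiv.refl β) := by
      rintro ⟨i, b⟩
      by_cases h : i = j
      · subst h
        right
        simp [hj]
      · left
        exact prodExtendRight_apply_ne _ h _
    rw [hmul, hd.cycleType_mul, ih, cycleType_prodExtendRight, Finset.card_insert_of_notMem hj,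
      add_smul, one_smul, add_comm]

lemma exists_pow_eq_prodCongr_refl {β : Type*} (ρ : Perm β) {r : ℕ} (hr : 0 < r) :
    ∃ π : Perm (Fin r × β), π ^ r = Equiv.prodCongr (Equiv.refl (Fin r)) ρ := by
  obtain ⟨k, rfl⟩ := Nat.exists_eq_succ_of_ne_zero hr.ne'
  let π : Perm (Fin (k + 1) × β) :=
    Equiv.prodShear (finRotate (k + 1)) fun j => if j = Fin.last k then ρ else Equiv.refl β
  have hπ : ∀ (b : β) (i : ℕ) (hi : i < k + 1), (π ^ i) (0, b) = (⟨i, hi⟩, b) := by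
    intro b i
    induction i with
    | zero => intro hi; rfl
    | succ i ih =>
      intro hi
      rw [pow_succ', mul_apply, ih (by omega)]
      have hne : (⟨i, by omega⟩ : Fin (k + 1)) ≠ Fin.last k := by
        rw [Ne, Fin.ext_iff, Fin.val_last]
        exact (Nat.lt_of_succ_lt_succ hi).ne
      simp only [π, Equiv.prodShear_apply, if_neg hne, Equiv.refl_apply]
      rw [finRotate_of_lt (Nat.lt_of_succ_lt_succ hi)]
  have hπ0 : ∀ b : β, (π ^ (k + 1)) (0, b) = (0, ρ b) := by
    intro b
    rw [pow_succ', mul_apply, hπ b k (by omega)]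
    have : (⟨k, by omega⟩ : Fin (k + 1)) = Fin.last k := rfl
    simp only [π, Equiv.prodShear_apply, this, if_true, finRotate_last]
  refine ⟨π, ?_⟩
  ext1 ⟨i, b⟩
  rw [← hπ b i i.2, ← mul_apply, pow_mul_comm, mul_apply, hπ0,
    hπ _ i i.2, hπ b i i.2]
  rfl

lemma exists_pow_eq_of_dvd_count {α : Type*} [Fintype α] [DecidableEq α] {σ : Perm α} {r : ℕ}
    (hr : 0 < r) (hσ : ∀ x, σ x ≠ x) (h : ∀ i, r ∣ σ.cycleType.count i) :
    ∃ π : Perm α, π ^ r = σ := by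
  obtain ⟨s, hs⟩ := Multiset.exists_smul_of_dvd_count σ.cycleType fun a _ => h a
  have hsum : Fintype.card α = r * s.sum := by
    have : σ.support = Finset.univ := by ext; simp [hσ]
    rw [← Finset.card_univ, ← this, ← sum_cycleType, hs, Multiset.sum_nsmul, smul_eq_mul]
  obtain ⟨ρ, hρ⟩ := (exists_with_cycleType_iff (Fin s.sum) (m := s)).2
    ⟨by simp, fun a ha => two_le_of_mem_cycleType (σ := σ) (by
      rw [hs]; exact (Multiset.mem_nsmul_of_ne_zero hr.ne').2 ha)⟩
  obtain ⟨π, hπ⟩ := exists_pow_eq_prodCongr_refl ρ hr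
  let e : Fin r × Fin s.sum ≃ α := Fintype.equivOfCardEq (by simp [hsum])
  have hc : (e.permCongr (π ^ r)).cycleType = σ.cycleType := by
    rw [cycleType_permCongr, hπ, hs]
    have := cycleType_prodShear_ite ρ (Finset.univ : Finset (Fin r))
    simp only [Finset.mem_univ, if_true, Finset.card_univ, Fintype.card_fin] at this
    rw [hρ] at this
    exact this
  obtain ⟨c, hc⟩ := isConj_iff.1 (isConj_iff_cycleType_eq.2 hc)
  refine ⟨c * e.permCongr π * c⁻¹, ?_⟩
  rw [conj_pow, ← hc]
  congr 2
  exact (map_pow (Equiv.permCongrHom e) π r).symm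

lemma exists_mul_of_subset_cycleFactorsFinset {α : Type*} [Fintype α] [DecidableEq α]
    {σ : Perm α} {S : Finset (Perm α)} (hS : S ⊆ σ.cycleFactorsFinset) :
    ∃ g h : Perm α, σ = g * h ∧ Disjoint g h ∧ g.cycleFactorsFinset = S := by
  have hcyc : ∀ c ∈ σ.cycleFactorsFinset, c.IsCycle := fun c hc =>
    (mem_cycleFactorsFinset_iff.1 hc).1
  have hd := cycleFactorsFinset_pairwise_disjoint σ
  have hcomm := cycleFactorsFinset_mem_commute σ
  have hu : S ∪ (σ.cycleFactorsFinset \ S) = σ.cycleFactorsFinset :=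
    Finset.union_sdiff_of_subset hS
  have hcommS : (S : Set (Perm α)).Pairwise Commute := hcomm.mono (by exact_mod_cast hS)
  have hcommT : ((σ.cycleFactorsFinset \ S : Finset (Perm α)) : Set (Perm α)).Pairwise Commute :=
    hcomm.mono (by exact_mod_cast Finset.sdiff_subset)
  refine ⟨S.noncommProd id hcommS, (σ.cycleFactorsFinset \ S).noncommProd id hcommT, ?_, ?_, ?_⟩
  · rw [← Finset.noncommProd_union_of_disjoint Finset.disjoint_sdiff id
      (by rw [hu]; exact hcomm)]
    simp only [hu]
    exact (cycleFactorsFinset_noncommProd σ).symm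
  · refine disjoint_noncommProd_right _ fun c hc => ?_
    refine (disjoint_noncommProd_right _ fun d hd' => ?_).symm
    rw [Finset.mem_sdiff] at hc
    exact hd hc.1 (hS hd') (by rintro rfl; exact hc.2 hd')
  · exact cycleFactorsFinset_eq_finset.2 ⟨fun c hc => hcyc c (hS hc),
      hd.mono (by exact_mod_cast hS), rfl⟩

lemma minimalPeriod_eq_card_support_cycleOf {α : Type*} [Fintype α] [DecidableEq α]
    {σ : Perm α} {x : α} (hx : σ x ≠ x) :
    Function.minimalPeriod σ x = (σ.cycleOf x).support.card := by
  have key : ∀ n, Function.IsPeriodicPt σ n x ↔ (σ.cycleOf x).support.card ∣ n := by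
    intro n
    rw [Function.IsPeriodicPt, Function.IsFixedPt, iterate_eq_pow]
    exact (isCycleOn_support_cycleOf σ x).pow_apply_eq (by simpa [mem_support_cycleOf_iff] using hx)
  exact Nat.dvd_antisymm ((Function.isPeriodicPt_minimalPeriod _ _).minimalPeriod_dvd.trans
    ((key _).2 dvd_rfl).minimalPeriod_dvd) ((key _).1 (Function.isPeriodicPt_minimalPeriod _ _))

lemma minimalPeriod_dvd_orderOf {α : Type*} (σ : Perm α) (x : α) :
    Function.minimalPeriod σ x ∣ orderOf σ := by
  apply Function.IsPeriodicPt.minimalPeriod_dvd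
  rw [Function.IsPeriodicPt, Function.IsFixedPt, iterate_eq_pow, pow_orderOf_eq_one, one_apply]

section SubtypeCongr

variable {α : Type*} {p : α → Prop} [DecidablePred p]
  (σ : Perm {a // p a}) (τ : Perm {a // ¬ p a})

lemma subtypeCongr_pow (n : ℕ) : (σ.subtypeCongr τ) ^ n = (σ ^ n).subtypeCongr (τ ^ n) :=
  (map_pow (subtypeCongrHom p) (σ, τ) n).symm

lemma minimalPeriod_subtypeCongr_left (x : {a // p a}) :
    Function.minimalPeriod (σ.subtypeCongr τ) x = Function.minimalPeriod σ x := by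
  rw [Function.minimalPeriod_eq_minimalPeriod_iff]
  intro n
  simp only [Function.IsPeriodicPt, Function.IsFixedPt, iterate_eq_pow, subtypeCongr_pow,
    subtypeCongr.left_apply_subtype, Subtype.ext_iff]

lemma minimalPeriod_subtypeCongr_right (x : {a // ¬ p a}) :
    Function.minimalPeriod (σ.subtypeCongr τ) x = Function.minimalPeriod τ x := by
  rw [Function.minimalPeriod_eq_minimalPeriod_iff]
  intro n
  simp only [Function.IsPeriodicPt, Function.IsFixedPt, iterate_eq_pow, subtypeCongr_pow,
    subtypeCongr.right_apply_subtype, Subtype.ext_iff]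

end SubtypeCongr

lemma exists_subtypeCongr_of_disjoint {α : Type*} [Fintype α] [DecidableEq α]
    {g h : Perm α} (hd : Disjoint g h) :
    ∃ (σ : Perm {a // a ∈ g.support}) (τ : Perm {a // a ∉ g.support}),
      σ.subtypeCongr τ = g * h ∧ σ.cycleType = g.cycleType ∧ τ.cycleType = h.cycleType := by
  have hh : ∀ x, h x ≠ x → x ∉ g.support := fun x hx hg => by
    rcases hd x with h1 | h1
    · exact (mem_support.1 hg) h1
    · exact hx h1
  have hinv : ∀ x, h x ∉ g.support ↔ x ∉ g.support := fun x => by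
    by_cases hx : h x = x
    · rw [hx]
    · exact iff_of_true (hh _ fun h' => hx (h.injective h')) (hh _ hx)
  refine ⟨g.subtypePerm fun x => by simp, h.subtypePerm hinv, ?_, ?_, ?_⟩
  · ext x
    rw [subtypeCongr.apply]
    split_ifs with hx
    · have : h x = x := by by_contra h'; exact hh _ h' hx
      simp [this]
    · have := (hinv x).2 hx
      rw [notMem_support] at this
      simp [this]
  · rw [← cycleType_ofSubtype, ofSubtype_subtypePerm _ (fun x hx => mem_support.2 hx)]
  · rw [← cycleType_ofSubtype, ofSubtype_subtypePerm _ hh]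

end Equiv.Perm

section CycQR

variable {α : Type*} [Fintype α] [DecidableEq α] {q r : ℕ} {σ : Equiv.Perm α}

lemma CycQR.apply_ne (h : CycQR q r σ) (hq : 1 < q) (x : α) : σ x ≠ x := by
  intro hx
  have h1 := h.1 x
  rw [Function.minimalPeriod_eq_one_iff_isFixedPt.2 hx] at h1
  exact hq.ne' (Nat.dvd_one.1 h1)

lemma CycQR.exists_subtypeCongr (h : CycQR q r σ) (hq : 1 < q) (hr : 0 < r) (x : α) :
    ∃ A : Finset α, x ∈ A ∧ q * r ∣ A.card ∧
      ∃ (ρ : Equiv.Perm {a // a ∈ A}) (τ : Equiv.Perm {a // a ∉ A}),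
        ρ.cycleType = Multiset.replicate r (A.card / r) ∧ CycQR q r τ ∧
          ρ.subtypeCongr τ = σ := by
  have hx := h.apply_ne hq x
  set k := (σ.cycleOf x).support.card with hk
  have hqk : q ∣ k := by
    rw [hk, ← Equiv.Perm.minimalPeriod_eq_card_support_cycleOf hx]
    exact h.1 x
  let T := σ.cycleFactorsFinset.filter fun c => c.support.card = k
  have hxT : σ.cycleOf x ∈ T := Finset.mem_filter.2
    ⟨Equiv.Perm.cycleOf_mem_cycleFactorsFinset_iff.2 (Equiv.Perm.mem_support.2 hx), rfl⟩
  have hT : T.card = σ.cycleType.count k := by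
    rw [Equiv.Perm.cycleType_def, Multiset.count_map]
    simp only [Function.comp_apply, eq_comm (a := k)]
    rfl
  have hrT : r ≤ T.card :=
    Nat.le_of_dvd (Finset.card_pos.2 ⟨_, hxT⟩) (hT ▸ h.2 k)
  obtain ⟨S, hxS, hST, hS⟩ := Finset.exists_subsuperset_card_eq
    (Finset.singleton_subset_iff.2 hxT) (by rw [Finset.card_singleton]; exact hr) hrT
  obtain ⟨g, g', hσ, hd, hg⟩ := Equiv.Perm.exists_mul_of_subset_cycleFactorsFinset
    (hST.trans (Finset.filter_subset _ _))
  have hgt : g.cycleType = Multiset.replicate r k := by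
    rw [Equiv.Perm.cycleType_def, hg, Multiset.eq_replicate]
    refine ⟨by simpa using hS, fun b hb => ?_⟩
    obtain ⟨c, hc, rfl⟩ := Multiset.mem_map.1 hb
    exact (Finset.mem_filter.1 (hST hc)).2
  have hA : g.support.card = r * k := by
    rw [← Equiv.Perm.sum_cycleType, hgt, Multiset.sum_replicate, smul_eq_mul]
  obtain ⟨ρ, τ, hρτ, hρ, hτ⟩ := Equiv.Perm.exists_subtypeCongr_of_disjoint hd
  refine ⟨g.support, ?_, ?_, ρ, τ, ?_, ⟨?_, ?_⟩, ?_⟩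
  · rw [Equiv.Perm.mem_support_iff_mem_support_of_mem_cycleFactorsFinset, hg]
    exact ⟨_, Finset.singleton_subset_iff.1 hxS, by
      simpa [Equiv.Perm.mem_support_cycleOf_iff] using hx⟩
  · rw [hA, mul_comm]
    exact mul_dvd_mul_left r hqk
  · rw [hρ, hgt, hA, Nat.mul_div_cancel_left _ hr]
  · intro y
    rw [← Equiv.Perm.minimalPeriod_subtypeCongr_right ρ τ, hρτ, ← hσ]
    exact h.1 y
  · intro i
    have hi := h.2 i
    rw [hσ, hd.cycleType_mul, Multiset.count_add, ← hτ] at hi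
    refine (Nat.dvd_add_right ?_).1 hi
    rw [hgt, Multiset.count_replicate]
    split_ifs <;> simp
  · rw [hρτ, hσ]

end CycQR

lemma Equiv.Perm.card_mul_card_cycleType_replicate_lt {β : Type*} [Fintype β] [DecidableEq β]
    {r : ℕ} (hr : 2 < r) (hdvd : r ∣ Fintype.card β) (hβ : 2 * r ≤ Fintype.card β) :
    Fintype.card β *
        Nat.card {σ : Perm β // σ.cycleType = Multiset.replicate r (Fintype.card β / r)} <
      Nat.card {σ : Perm β // σ.cycleType = {Fintype.card β - 1}} := by
  obtain ⟨k, hk⟩ := hdvd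
  have hk2 : 2 ≤ k := by
    rw [hk, mul_comm r k] at hβ
    exact Nat.le_of_mul_le_mul_right hβ (by omega)
  obtain ⟨M, hM⟩ : ∃ M, Fintype.card β = M + 2 := ⟨Fintype.card β - 2, by omega⟩
  rw [Nat.card_eq_fintype_card, Nat.card_eq_fintype_card, Fintype.card_subtype,
    Fintype.card_subtype, card_of_cycleType_singleton (by omega) (by omega)]
  have hR := card_of_cycleType_mul_eq β (Multiset.replicate r (Fintype.card β / r))
  have hdiv : Fintype.card β / r = k := by rw [hk, Nat.mul_div_cancel_left _ (by omega)]
  rw [hdiv] at hR ⊢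
  rw [if_pos ⟨by rw [Multiset.sum_replicate, smul_eq_mul, hk],
      fun a ha => by rwa [Multiset.eq_of_mem_replicate ha]⟩, Multiset.sum_replicate, smul_eq_mul,
    ← hk, Nat.sub_self, Nat.factorial_zero, one_mul, Multiset.prod_replicate,
    Multiset.toFinset_replicate, if_neg (by omega), Finset.prod_singleton,
    Multiset.count_replicate_self] at hR
  set R := (Finset.univ.filter fun σ : Perm β => σ.cycleType = Multiset.replicate r k).card
  rw [hM] at hR hk ⊢
  have hchoose : (M + 2).choose (M + 2 - 1) = M + 2 := by
    rw [show M + 2 - 1 = M + 1 from rfl, Nat.choose_succ_self_right]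
  rw [hchoose, show M + 2 - 1 - 1 = M from rfl, mul_comm]
  refine Nat.mul_lt_mul_of_pos_right ?_ (by omega)
  have hfac : r ^ 2 ≤ 2 * r.factorial := by
    obtain ⟨t, rfl⟩ : ∃ t, r = t + 1 := ⟨r - 1, by omega⟩
    have := Nat.self_le_factorial t
    rw [Nat.factorial_succ]
    nlinarith
  have hpow : (r * k) ^ 2 ≤ k ^ r * r.factorial := by
    obtain ⟨t, rfl⟩ : ∃ t, r = t + 3 := ⟨r - 3, by omega⟩
    have h1 : 1 ≤ k ^ t := Nat.one_le_pow _ _ (by omega)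
    calc ((t + 3) * k) ^ 2 = (t + 3) ^ 2 * k ^ 2 := by ring
      _ ≤ (2 * (t + 3).factorial) * k ^ 2 := by gcongr
      _ = 1 * k ^ 2 * 2 * (t + 3).factorial := by ring
      _ ≤ k ^ t * k ^ 2 * k * (t + 3).factorial := by gcongr
      _ = k ^ (t + 3) * (t + 3).factorial := by ring
  by_contra! hle
  have h2 : M.factorial * (M + 2) ^ 2 ≤ (M + 2).factorial := by
    rw [← hR, hk]
    exact Nat.mul_le_mul hle hpow
  rw [Nat.factorial_succ, Nat.factorial_succ] at h2
  nlinarith [M.factorial_pos]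

section Singleton

variable {β : Type*} [Fintype β] [DecidableEq β] {q n : ℕ} {σ : Equiv.Perm β}

lemma not_dvd_orderOf_of_cycleType_eq_singleton (hq : 1 < q) (hn : 0 < n) (hqn : q ∣ n)
    (hσ : σ.cycleType = {n - 1}) : ¬ q ∣ orderOf σ := by
  intro h
  rw [← σ.lcm_cycleType, hσ, Multiset.lcm_singleton, normalize_eq] at h
  have h1 := Nat.dvd_sub hqn h
  rw [Nat.sub_sub_self hn] at h1
  exact hq.ne' (Nat.dvd_one.1 h1)

lemma exists_pow_eq_of_cycleType_eq_singleton (hq : q.Prime) (l : ℕ) (hn : 0 < n) (hqn : q ∣ n)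
    (hσ : σ.cycleType = {n - 1}) : ∃ π : Equiv.Perm β, π ^ (q ^ l) = σ := by
  have hcop : (q ^ l).Coprime (orderOf σ) := Nat.Coprime.pow_left _
    (hq.coprime_iff_not_dvd.2 (not_dvd_orderOf_of_cycleType_eq_singleton hq.one_lt hn hqn hσ))
  obtain ⟨k, hk⟩ := exists_pow_eq_self_of_coprime hcop
  exact ⟨σ ^ k, by rw [← pow_mul, mul_comm, pow_mul, hk]⟩

end Singleton

lemma card_mul_card_cycQR_lt {α : Type*} [Fintype α] [DecidableEq α] [Nonempty α] {q l r : ℕ}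
    (hq : q.Prime) (hr : r = q ^ l) (hr2 : 2 < r) (hα : q * r ∣ Fintype.card α) :
    Fintype.card α * Nat.card {σ : Equiv.Perm α // CycQR q r σ} <
      Nat.card {σ : Equiv.Perm α // ∃ π, π ^ r = σ} := by
  classical
  let I := {A : Finset α // A.Nonempty ∧ q * r ∣ A.card}
  let X := Σ A : I, {a // a ∈ A.1} ×
    ({ρ : Equiv.Perm {a // a ∈ A.1} // ρ.cycleType = Multiset.replicate r (A.1.card / r)} ×
      {τ : Equiv.Perm {a // a ∉ A.1} // CycQR q r τ})
  let Y := Σ A : I, {ρ : Equiv.Perm {a // a ∈ A.1} // ρ.cycleType = {A.1.card - 1}} ×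
      {τ : Equiv.Perm {a // a ∉ A.1} // CycQR q r τ}
  have hX : Fintype.card α * Nat.card {σ : Equiv.Perm α // CycQR q r σ} ≤ Nat.card X := by
    rw [← Nat.card_eq_fintype_card, ← Nat.card_prod]
    have key : ∀ y : α × {σ : Equiv.Perm α // CycQR q r σ}, ∃ z : X,
        (z.2.1 : α) = y.1 ∧ z.2.2.1.1.subtypeCongr z.2.2.2.1 = y.2.1 := by
      rintro ⟨x, σ, hσ⟩
      obtain ⟨A, hxA, hA, ρ, τ, hρ, hτ, h⟩ :=
        hσ.exists_subtypeCongr hq.one_lt (by omega) x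
      exact ⟨⟨⟨A, ⟨x, hxA⟩, hA⟩, ⟨x, hxA⟩, ⟨ρ, hρ⟩, ⟨τ, hτ⟩⟩, rfl, h⟩
    choose f hf1 hf2 using key
    refine Nat.card_le_card_of_injective f fun y y' h => ?_
    refine Prod.ext ?_ (Subtype.ext ?_)
    · rw [← hf1, ← hf1, h]
    · rw [← hf2, ← hf2, h]
  have hlt : ∀ A : I, A.1.card *
      Nat.card {ρ : Equiv.Perm {a // a ∈ A.1} //
        ρ.cycleType = Multiset.replicate r (A.1.card / r)} <
      Nat.card {ρ : Equiv.Perm {a // a ∈ A.1} // ρ.cycleType = {A.1.card - 1}} := by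
    rintro ⟨A, hA, hdvd⟩
    have hle := Nat.le_of_dvd (Finset.card_pos.2 hA) hdvd
    have := Equiv.Perm.card_mul_card_cycleType_replicate_lt (β := {a // a ∈ A}) hr2
      (by rw [Fintype.card_coe]; exact (dvd_mul_left r q).trans hdvd)
      (by rw [Fintype.card_coe]; exact (Nat.mul_le_mul_right r hq.two_le).trans hle)
    rwa [Fintype.card_coe] at this
  have hXY : Nat.card X < Nat.card Y := by
    have hcard : ∀ A : I, Nat.card {a // a ∈ A.1} = A.1.card := fun A => by
      rw [Nat.card_eq_fintype_card, Fintype.card_coe]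
    rw [Nat.card_sigma, Nat.card_sigma]
    simp only [Nat.card_prod, ← mul_assoc, hcard]
    refine Finset.sum_lt_sum (fun A _ => Nat.mul_le_mul_right _ (hlt A).le)
      ⟨⟨Finset.univ, Finset.univ_nonempty, by rwa [Finset.card_univ]⟩, Finset.mem_univ _,
        Nat.mul_lt_mul_of_pos_right (hlt _) ?_⟩
    have : IsEmpty {a : α // a ∉ (Finset.univ : Finset α)} := ⟨fun a => a.2 (Finset.mem_univ _)⟩
    have hone : CycQR q r (1 : Equiv.Perm {a : α // a ∉ (Finset.univ : Finset α)}) :=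
      ⟨fun x => isEmptyElim x, fun i => by simp⟩
    exact Nat.card_pos_iff.2 ⟨⟨⟨1, hone⟩⟩, inferInstance⟩
  have hY : Nat.card Y ≤ Nat.card {σ : Equiv.Perm α // ∃ π, π ^ r = σ} := by
    have hroot : ∀ z : Y, ∃ π : Equiv.Perm α, π ^ r = z.2.1.1.subtypeCongr z.2.2.1 := by
      rintro ⟨⟨A, hA, hdvd⟩, ⟨ρ, hρ⟩, ⟨τ, hτ⟩⟩
      obtain ⟨π₁, h₁⟩ := exists_pow_eq_of_cycleType_eq_singleton hq l
        (Finset.card_pos.2 hA) ((dvd_mul_right q r).trans hdvd) hρ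
      obtain ⟨π₂, h₂⟩ := Equiv.Perm.exists_pow_eq_of_dvd_count (by omega)
        (hτ.apply_ne hq.one_lt) hτ.2
      refine ⟨π₁.subtypeCongr π₂, ?_⟩
      rw [← hr] at h₁
      rw [Equiv.Perm.subtypeCongr_pow, h₂, h₁]
    have hmem : ∀ (z : Y) (a : α),
        a ∈ z.1.1 ↔ ¬ q ∣ Function.minimalPeriod (z.2.1.1.subtypeCongr z.2.2.1) a := by
      rintro ⟨⟨A, hA, hdvd⟩, ⟨ρ, hρ⟩, ⟨τ, hτ⟩⟩ a
      by_cases ha : a ∈ A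
      · refine iff_of_true ha ?_
        rw [ρ.minimalPeriod_subtypeCongr_left τ ⟨a, ha⟩]
        exact fun h => not_dvd_orderOf_of_cycleType_eq_singleton hq.one_lt
          (Finset.card_pos.2 hA) ((dvd_mul_right q r).trans hdvd) hρ
          (h.trans (ρ.minimalPeriod_dvd_orderOf _))
      · refine iff_of_false ha (not_not.2 ?_)
        rw [ρ.minimalPeriod_subtypeCongr_right τ ⟨a, ha⟩]
        exact hτ.1 _
    refine Nat.card_le_card_of_injective
      (fun z : Y => ⟨z.2.1.1.subtypeCongr z.2.2.1, hroot z⟩) fun z z' h => ?_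
    have hσ : z.2.1.1.subtypeCongr z.2.2.1 = z'.2.1.1.subtypeCongr z'.2.2.1 :=
      congrArg Subtype.val h
    have hA : z.1 = z'.1 := Subtype.ext (Finset.ext fun a => by rw [hmem, hmem, hσ])
    obtain ⟨A, ⟨ρ, hρ⟩, ⟨τ, hτ⟩⟩ := z
    obtain ⟨A', ⟨ρ', hρ'⟩, ⟨τ', hτ'⟩⟩ := z'
    obtain rfl : A = A' := hA
    have hpair : (ρ, τ) = (ρ', τ') := Equiv.Perm.subtypeCongrHom_injective (· ∈ A.1) hσ
    obtain ⟨rfl, rfl⟩ := Prod.mk.inj hpair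
    rfl
  exact (hX.trans_lt hXY).trans_le hY

/-- for a prime power `r = q^l > 2` and `m ≥ 1`:
`|S_{mqr}^r| > mqr · |Cyc_{q,r}(mqr)|`. -/
theorem stmt17 (q l r m : ℕ) (hq : Nat.Prime q) (hl : 1 ≤ l) (hr : r = q ^ l)
    (hr2 : 2 < r) (hm : 1 ≤ m) :
    Nat.card {σ : Equiv.Perm (Fin (m * q * r)) // ∃ π, π ^ r = σ} >
      m * q * r *
        Nat.card {σ : Equiv.Perm (Fin (m * q * r)) // CycQR q r σ} := by
  have hpos : 0 < m * q * r := Nat.mul_pos (Nat.mul_pos hm hq.pos) (by omega)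
  have : Nonempty (Fin (m * q * r)) := ⟨⟨0, hpos⟩⟩
  have := card_mul_card_cycQR_lt (α := Fin (m * q * r)) hq hr hr2
    (by rw [Fintype.card_fin, mul_assoc]; exact dvd_mul_left _ _)
  rwa [Fintype.card_fin] at this
end

section
/- Let r = q^l be a prime power with q prime and l ≥ 1, and let n ≥ 1 with n+1 divisible by q but not by qr. Then n · |S_n^r| ≥ |S_{n+1}^r|, i.e., p_r(n) ≥ ((n+1)/n) · p_r(n+1), where p_r(n) is the probability that a uniformly random permutation of {1,...,n} has an r-th root. -/
namespace PermRoot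

open Function

lemma card_subtype_eq_sum_fiber {A B : Type*} [Finite A] [Fintype B] (P : A → Prop) (f : A → B) :
    Nat.card {a // P a} = ∑ b, Nat.card {a // f a = b ∧ P a} := by
  rw [← Nat.card_sigma]
  exact Nat.card_congr
    { toFun := fun a => ⟨f a, a, rfl, a.2⟩
      invFun := fun x => ⟨x.2, x.2.2.2⟩
      left_inv := fun a => rfl
      right_inv := by rintro ⟨b, a, rfl, h⟩; rfl }

section Split

variable {α : Type*} {p : α → Prop} [DecidablePred p]
  (a : Equiv.Perm {x // p x}) (b : Equiv.Perm {x // ¬ p x})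

lemma exists_subtypeCongr_eq {σ : Equiv.Perm α} (h : ∀ x, p (σ x) ↔ p x) :
    ∃ a b, Equiv.Perm.subtypeCongr (p := p) a b = σ := by
  refine ⟨σ.subtypePerm h, σ.subtypePerm fun x => not_congr (h x), ?_⟩
  ext x
  by_cases hx : p x
  · simp [Equiv.Perm.subtypeCongr.left_apply, hx]
  · simp [Equiv.Perm.subtypeCongr.right_apply, hx]

lemma subtypeCongr_pow (n : ℕ) : (a ^ n).subtypeCongr (b ^ n) = a.subtypeCongr b ^ n :=
  map_pow (Equiv.Perm.subtypeCongrHom p) (a, b) n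

lemma subtypeCongr_zpow (n : ℤ) : (a ^ n).subtypeCongr (b ^ n) = a.subtypeCongr b ^ n :=
  map_zpow (Equiv.Perm.subtypeCongrHom p) (a, b) n

lemma subtypeCongr_inj {a a' : Equiv.Perm {x // p x}} {b b' : Equiv.Perm {x // ¬ p x}} :
    a.subtypeCongr b = a'.subtypeCongr b' ↔ a = a' ∧ b = b' := by
  rw [← Prod.mk_inj, ← (Equiv.Perm.subtypeCongrHom_injective p).eq_iff]; rfl

lemma minimalPeriod_eq_of_semiconj {α β : Type*} {f : α → α} {g : β → β} {i : α → β}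
    (hi : Injective i) (h : Semiconj i f g) (x : α) :
    minimalPeriod g (i x) = minimalPeriod f x := by
  rw [minimalPeriod_eq_minimalPeriod_iff]
  intro n
  simp only [IsPeriodicPt, IsFixedPt, ← (h.iterate_right n).eq, hi.eq_iff]

lemma minimalPeriod_subtypeCongr_left (x : {x // p x}) :
    minimalPeriod (a.subtypeCongr b) x = minimalPeriod a x :=
  minimalPeriod_eq_of_semiconj Subtype.val_injective (fun y => by simp) x

lemma minimalPeriod_subtypeCongr_right (x : {x // ¬ p x}) :
    minimalPeriod (a.subtypeCongr b) x = minimalPeriod b x :=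
  minimalPeriod_eq_of_semiconj Subtype.val_injective (fun y => by simp) x

lemma card_eq_mul_of_split {P : Equiv.Perm α → Prop}
    {Q : Equiv.Perm {x // p x} → Prop} {R : Equiv.Perm {x // ¬ p x} → Prop}
    (hP : ∀ σ, P σ → ∀ x, p (σ x) ↔ p x) (hQR : ∀ a b, P (a.subtypeCongr b) ↔ Q a ∧ R b) :
    Nat.card {σ // P σ} = Nat.card {a // Q a} * Nat.card {b // R b} := by
  rw [← Nat.card_prod]
  symm
  refine Nat.card_congr (Equiv.ofBijective
    (fun x => ⟨x.1.1.subtypeCongr x.2.1, (hQR _ _).2 ⟨x.1.2, x.2.2⟩⟩) ⟨?_, ?_⟩)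
  · rintro ⟨⟨a, ha⟩, b, hb⟩ ⟨⟨a', ha'⟩, b', hb'⟩ h
    simpa [subtypeCongr_inj] using h
  · rintro ⟨σ, hσ⟩
    obtain ⟨a, b, rfl⟩ := exists_subtypeCongr_eq (hP σ hσ)
    have := (hQR _ _).1 hσ
    exact ⟨(⟨a, this.1⟩, ⟨b, this.2⟩), rfl⟩

end Split

section Counting

/-- The number of permutations of `Fin n` all of whose cycle lengths, fixed points included,
satisfy `P`. -/
noncomputable def cycleCount (P : ℕ → Prop) (n : ℕ) : ℕ :=
  Nat.card {σ : Equiv.Perm (Fin n) // ∀ x, P (minimalPeriod σ x)}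

/-- The number of cyclic permutations of `Fin n`. -/
noncomputable def cyclicCount (n : ℕ) : ℕ :=
  Nat.card {σ : Equiv.Perm (Fin n) // ∀ x y, σ.SameCycle x y}

lemma minimalPeriod_permCongr {α β : Type*} (e : α ≃ β) (σ : Equiv.Perm α) (x : α) :
    minimalPeriod (e.permCongr σ) (e x) = minimalPeriod σ x :=
  minimalPeriod_eq_of_semiconj e.injective (fun y => by simp) x

lemma card_eq_cycleCount {α : Type*} [Finite α] (P : ℕ → Prop) {n : ℕ} (h : Nat.card α = n) :
    Nat.card {σ : Equiv.Perm α // ∀ x, P (minimalPeriod σ x)} = cycleCount P n := by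
  subst h
  let e := Finite.equivFin α
  refine Nat.card_congr (e.permCongr.subtypeEquiv fun σ => ?_)
  rw [← e.forall_congr_right]
  simp_rw [minimalPeriod_permCongr]

lemma card_eq_cyclicCount {α : Type*} [Finite α] {n : ℕ} (h : Nat.card α = n) :
    Nat.card {σ : Equiv.Perm α // ∀ x y, σ.SameCycle x y} = cyclicCount n := by
  subst h
  let e := Finite.equivFin α
  refine Nat.card_congr (e.permCongr.subtypeEquiv fun σ => ?_)
  rw [← e.forall_congr_right]
  refine forall_congr' fun x => ?_
  rw [← e.forall_congr_right]
  refine forall_congr' fun y => ?_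
  have : ∀ i : ℤ, (e.permCongr σ) ^ i = e.permCongr (σ ^ i) := fun i =>
    (map_zpow e.permCongrHom σ i).symm
  simp [Equiv.Perm.SameCycle, this]

lemma orbit_zpowers_eq {α : Type*} (σ : Equiv.Perm α) (x : α) :
    MulAction.orbit (Subgroup.zpowers σ) x = {y | σ.SameCycle x y} := by
  ext y
  simp [MulAction.mem_orbit_iff, Equiv.Perm.SameCycle, Subgroup.smul_def]

lemma minimalPeriod_eq_card_sameCycle {α : Type*} [Finite α] (σ : Equiv.Perm α) (x : α) :
    minimalPeriod σ x = Nat.card {y // σ.SameCycle x y} := by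
  have := Fintype.ofFinite (MulAction.orbit (Subgroup.zpowers σ) x)
  have h := MulAction.minimalPeriod_eq_card σ x
  rw [← Nat.card_eq_fintype_card, orbit_zpowers_eq] at h
  exact h

lemma dvd_card_of_forall_dvd_minimalPeriod {α : Type*} [Finite α] (σ : Equiv.Perm α) {k : ℕ}
    (h : ∀ x, k ∣ minimalPeriod σ x) : k ∣ Nat.card α := by
  have := Fintype.ofFinite (MulAction.orbitRel.Quotient (Subgroup.zpowers σ) α)
  rw [Nat.card_congr (MulAction.selfEquivSigmaOrbits (Subgroup.zpowers σ) α), Nat.card_sigma]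
  refine Finset.dvd_sum fun ω _ => ?_
  have := h ω.out
  rwa [minimalPeriod_eq_card_sameCycle, ← Set.coe_ofPred, ← orbit_zpowers_eq] at this

lemma card_fiber_sameCycle {n : ℕ} (P : ℕ → Prop) [DecidablePred P] (s : Finset (Fin n))
    (x : Fin n) :
    Nat.card {σ : Equiv.Perm (Fin n) //
      Finset.univ.filter (σ.SameCycle x) = s ∧ ∀ y, P (minimalPeriod σ y)} =
    if x ∈ s then if P s.card then cyclicCount s.card * cycleCount P (n - s.card) else 0 else 0 := by
  split_ifs with hx hP
  · rw [card_eq_mul_of_split (p := (· ∈ s)) (Q := fun a => ∀ x y, a.SameCycle x y)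
      (R := fun b => ∀ y, P (minimalPeriod b y)), card_eq_cyclicCount (n := s.card) (by simp),
      card_eq_cycleCount P (n := n - s.card)]
    · simp [Fintype.card_subtype_compl]
    · rintro σ ⟨rfl, -⟩ y
      simp
    · intro a b
      have hab : ∀ y : {y // y ∈ s},
          (a.subtypeCongr b).SameCycle x y ↔ a.SameCycle ⟨x, hx⟩ y := by
        intro y
        refine exists_congr fun i => ?_
        rw [← subtypeCongr_zpow, Equiv.Perm.subtypeCongr.left_apply _ _ hx, Subtype.val_inj]
      constructor
      · rintro ⟨hs, hreg⟩
        have hcyc : ∀ y : {y // y ∈ s}, a.SameCycle ⟨x, hx⟩ y := fun y =>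
          (hab y).1 (by simpa using hs.ge y.2)
        exact ⟨fun y z => (hcyc y).symm.trans (hcyc z),
          fun y => minimalPeriod_subtypeCongr_right a b y ▸ hreg y⟩
      · rintro ⟨hcyc, hreg⟩
        constructor
        · ext y
          simp only [Finset.mem_filter, Finset.mem_univ, true_and]
          refine ⟨?_, fun hy => (hab ⟨y, hy⟩).2 (hcyc _ _)⟩
          rintro ⟨i, rfl⟩
          rw [← subtypeCongr_zpow, Equiv.Perm.subtypeCongr.left_apply _ _ hx]
          exact Subtype.prop _
        · intro y
          by_cases hy : y ∈ s
          · rw [minimalPeriod_subtypeCongr_left a b ⟨y, hy⟩, minimalPeriod_eq_card_sameCycle,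
              Nat.card_congr (Equiv.subtypeUnivEquiv (hcyc _))]
            simpa using hP
          · rw [minimalPeriod_subtypeCongr_right a b ⟨y, hy⟩]
            exact hreg _
  · rw [Nat.card_eq_zero]
    left
    constructor
    rintro ⟨σ, rfl, h⟩
    have := h x
    rw [minimalPeriod_eq_card_sameCycle, Nat.card_eq_fintype_card, Fintype.card_subtype] at this
    exact hP this
  · rw [Nat.card_eq_zero]
    left
    constructor
    rintro ⟨σ, rfl, h⟩
    exact hx (by simpa using Equiv.Perm.SameCycle.refl σ x)

lemma mul_cycleCount (P : ℕ → Prop) [DecidablePred P] (n : ℕ) :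
    n * cycleCount P n = ∑ j ∈ Finset.range (n + 1), n.choose j *
      (if P j then j * cyclicCount j * cycleCount P (n - j) else 0) := by
  have h1 : n * cycleCount P n = ∑ x : Fin n, cycleCount P n := by simp
  have h2 := Finset.sum_powerset_apply_card (fun j =>
    if P j then j * cyclicCount j * cycleCount P (n - j) else 0) (x := (Finset.univ : Finset (Fin n)))
  simp only [Finset.card_univ, Fintype.card_fin, smul_eq_mul] at h2
  rw [← h2, h1]
  have h3 : ∀ x : Fin n, cycleCount P n = ∑ s : Finset (Fin n), if x ∈ s then
      if P s.card then cyclicCount s.card * cycleCount P (n - s.card) else 0 else 0 := by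
    intro x
    rw [cycleCount, card_subtype_eq_sum_fiber _
      (fun σ : Equiv.Perm (Fin n) => Finset.univ.filter (σ.SameCycle x))]
    exact Finset.sum_congr rfl fun s _ => card_fiber_sameCycle P s x
  rw [Finset.sum_congr rfl fun x _ => h3 x, Finset.sum_comm, Finset.powerset_univ]
  refine Finset.sum_congr rfl fun s _ => ?_
  rw [← Finset.sum_filter]
  simp [mul_assoc]

lemma cycleCount_true (n : ℕ) : cycleCount (fun _ => True) n = n.factorial := by
  simp [cycleCount, Fintype.card_perm]

lemma cyclicCount_eq (n : ℕ) (hn : n ≠ 0) : n * cyclicCount n = n.factorial := by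
  have key : ∀ n : ℕ, ∑ j ∈ Finset.range (n + 1), ((j * cyclicCount j : ℕ) : ℚ) / j.factorial = n := by
    intro n
    have h := mul_cycleCount (fun _ => True) n
    simp only [cycleCount_true, if_true] at h
    have h' : (n : ℚ) * n.factorial = ∑ j ∈ Finset.range (n + 1),
        (n.choose j : ℚ) * ((j * cyclicCount j : ℕ) * (n - j).factorial) := by exact_mod_cast h
    have hf : (n.factorial : ℚ) ≠ 0 := by positivity
    rw [← mul_left_inj' hf, h', Finset.sum_mul]
    refine Finset.sum_congr rfl fun j hj => ?_
    have hj' : j ≤ n := by simpa [Nat.lt_succ_iff] using hj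
    rw [Nat.cast_choose ℚ hj']
    field_simp
  obtain ⟨m, rfl⟩ := Nat.exists_eq_succ_of_ne_zero hn
  have h1 := key (m + 1)
  rw [Finset.sum_range_succ, key m] at h1
  have hf : ((m + 1).factorial : ℚ) ≠ 0 := by positivity
  have h2 : (((m + 1) * cyclicCount (m + 1) : ℕ) : ℚ) / (m + 1).factorial = 1 := by
    push_cast at h1 ⊢; linarith
  rw [div_eq_one_iff_eq hf] at h2
  exact_mod_cast h2

/-- The proportion of permutations of `Fin n` without cycle lengths divisible by `q`. -/
noncomputable def regularRatio (q n : ℕ) : ℚ := cycleCount (fun j => ¬ q ∣ j) n / n.factorial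

lemma mul_regularRatio (q n : ℕ) :
    n * regularRatio q n =
      ∑ i ∈ Finset.range n, if q ∣ n - i then 0 else regularRatio q i := by
  have h := mul_cycleCount (fun j => ¬ q ∣ j) n
  have h' : (n : ℚ) * cycleCount (fun j => ¬ q ∣ j) n = ∑ j ∈ Finset.range (n + 1),
      (n.choose j : ℚ) * (if ¬ q ∣ j then (j * cyclicCount j : ℕ) *
        (cycleCount (fun j => ¬ q ∣ j) (n - j) : ℚ) else 0) := by exact_mod_cast h
  have hf : (n.factorial : ℚ) ≠ 0 := by positivity
  rw [regularRatio, ← mul_div_assoc, h', Finset.sum_div, ← Finset.sum_range_reflect,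
    Finset.sum_range_succ]
  simp only [add_tsub_cancel_right, tsub_self, dvd_zero, not_true, if_false, mul_zero, zero_div,
    add_zero]
  refine Finset.sum_congr rfl fun i hi => ?_
  have hi' : i < n := by simpa using hi
  split_ifs with hd
  · simp
  · rw [cyclicCount_eq _ (by omega), Nat.cast_choose ℚ (by omega), Nat.sub_sub_self hi'.le,
      regularRatio]
    field_simp

section Recursion

variable {q : ℕ} {h : ℕ → ℚ}

lemma recursion_step (H : ∀ n : ℕ, n * h n = ∑ i ∈ Finset.range n, if q ∣ n - i then 0 else h i)
    (n : ℕ) :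
    (n + 1 : ℕ) * h (n + 1) = n * h n + h n -
      (∑ i ∈ Finset.range n, if q ∣ n - i then h (i + 1) - h i else 0) -
      if q ∣ n + 1 then h 0 else 0 := by
  have H' : ∀ n : ℕ, n * h n = ∑ i ∈ Finset.range n, h i -
      ∑ i ∈ Finset.range n, if q ∣ n - i then h i else 0 := by
    intro n
    rw [H, ← Finset.sum_sub_distrib]
    exact Finset.sum_congr rfl fun i _ => by split_ifs <;> simp
  have hsub : (∑ i ∈ Finset.range n, if q ∣ n - i then h (i + 1) - h i else 0) =
      (∑ i ∈ Finset.range n, if q ∣ n - i then h (i + 1) else 0) -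
      ∑ i ∈ Finset.range n, if q ∣ n - i then h i else 0 := by
    rw [← Finset.sum_sub_distrib]
    exact Finset.sum_congr rfl fun i _ => by split_ifs <;> simp
  rw [H' (n + 1), H' n, hsub, Finset.sum_range_succ,
    Finset.sum_range_succ' (fun i => if q ∣ n + 1 - i then h i else 0)]
  simp only [Nat.add_sub_add_right, Nat.sub_zero]
  ring

lemma recursion_of_not_dvd
    (H : ∀ n : ℕ, n * h n = ∑ i ∈ Finset.range n, if q ∣ n - i then 0 else h i)
    (n : ℕ) (hn : ¬ q ∣ n + 1) : h (n + 1) = h n := by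
  induction n using Nat.strong_induction_on with
  | _ n ih =>
    have h0 := recursion_step H n
    rw [Finset.sum_eq_zero, if_neg hn] at h0
    · have : ((n + 1 : ℕ) : ℚ) ≠ 0 := by positivity
      rw [← mul_right_inj' this, h0]
      push_cast
      ring
    · intro i hi
      have hi : i < n := by simpa using hi
      split_ifs with hd
      · rw [ih i hi, sub_self]
        intro hd'
        have := dvd_add hd hd'
        exact hn (by rwa [show n - i + (i + 1) = n + 1 by omega] at this)
      · rfl

lemma recursion_of_dvd
    (H : ∀ n : ℕ, n * h n = ∑ i ∈ Finset.range n, if q ∣ n - i then 0 else h i)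
    (n : ℕ) (hn : q ∣ n + 1) : (n + 1 : ℕ) * h (n + 1) = n * h n := by
  rw [recursion_step H n, if_pos hn, Finset.sum_congr rfl (g := fun i => h (i + 1) - h i),
    Finset.sum_range_sub]
  · ring
  · intro i hi
    have hi : i < n := by simpa using hi
    split_ifs with hd
    · rfl
    · rw [recursion_of_not_dvd H i, sub_self]
      intro hd'
      have := Nat.dvd_sub hn hd'
      exact hd (by rwa [Nat.add_sub_add_right] at this)

end Recursion

lemma cycleCount_succ_of_dvd {q n : ℕ} (h : q ∣ n + 1) :
    cycleCount (fun j => ¬ q ∣ j) (n + 1) = n * cycleCount (fun j => ¬ q ∣ j) n := by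
  have h1 := recursion_of_dvd (mul_regularRatio q) n h
  have hf : (n.factorial : ℚ) ≠ 0 := by positivity
  have hn : ((n + 1 : ℕ) : ℚ) ≠ 0 := by positivity
  rw [regularRatio, regularRatio, Nat.factorial_succ] at h1
  push_cast at h1 hn
  field_simp at h1
  exact_mod_cast h1

end Counting

section Roots

/-- The number of permutations of `Fin n` that have an `r`-th root and all of whose cycle lengths
are divisible by `q`. -/
noncomputable def singularRootCount (q r n : ℕ) : ℕ :=
  Nat.card {σ : Equiv.Perm (Fin n) // (∀ x, q ∣ minimalPeriod σ x) ∧ ∃ π, π ^ r = σ}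

lemma card_eq_singularRootCount {α : Type*} [Finite α] (q r : ℕ) {n : ℕ} (h : Nat.card α = n) :
    Nat.card {σ : Equiv.Perm α // (∀ x, q ∣ minimalPeriod σ x) ∧ ∃ π, π ^ r = σ} =
      singularRootCount q r n := by
  subst h
  let e := Finite.equivFin α
  refine Nat.card_congr (e.permCongr.subtypeEquiv fun σ => and_congr ?_ ?_)
  · rw [← e.forall_congr_right]
    simp_rw [minimalPeriod_permCongr]
  · rw [← e.permCongr.exists_congr_right]
    refine exists_congr fun π => ?_
    rw [← e.permCongr.injective.eq_iff]
    exact Eq.congr_left (map_pow e.permCongrHom π r)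

lemma exists_pow_eq_of_forall_not_dvd {α : Type*} [Finite α] {q : ℕ} (hq : q.Prime) (l : ℕ)
    (σ : Equiv.Perm α) (h : ∀ x, ¬ q ∣ minimalPeriod σ x) : ∃ π, π ^ q ^ l = σ := by
  have := Fintype.ofFinite α
  have hdvd : orderOf σ ∣ ∏ x, minimalPeriod σ x := by
    rw [orderOf_dvd_iff_pow_eq_one]
    ext x
    rw [← Equiv.Perm.iterate_eq_pow]
    exact isPeriodicPt_iff_minimalPeriod_dvd.2 (Finset.dvd_prod_of_mem _ (Finset.mem_univ x))
  have hcop : (q ^ l).Coprime (orderOf σ) := by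
    refine Nat.Coprime.coprime_dvd_right hdvd (Nat.Coprime.pow_left _ ?_)
    exact Nat.Coprime.prod_right fun x _ => (Nat.Prime.coprime_iff_not_dvd hq).2 (h x)
  obtain ⟨m, hm⟩ := exists_pow_eq_self_of_coprime hcop
  exact ⟨σ ^ m, by rw [← pow_mul, mul_comm, pow_mul, hm]⟩

lemma mul_dvd_of_dvd_div_gcd {q : ℕ} (hq : q.Prime) {l m : ℕ}
    (h : q ∣ m / m.gcd (q ^ l)) : q * q ^ l ∣ m := by
  obtain ⟨k, -, hk⟩ := (Nat.dvd_prime_pow hq).1 (Nat.gcd_dvd_right m (q ^ l))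
  have hkm : q ^ (k + 1) ∣ m := by
    have := Nat.mul_dvd_mul h (dvd_refl (m.gcd (q ^ l)))
    rwa [Nat.div_mul_cancel (Nat.gcd_dvd_left _ _), hk, ← pow_succ'] at this
  rcases Nat.lt_or_ge k l with hkl | hkl
  · have := Nat.dvd_gcd hkm (pow_dvd_pow q (show k + 1 ≤ l from hkl))
    rw [hk, Nat.pow_dvd_pow_iff_le_right hq.one_lt] at this
    omega
  · rw [← pow_succ']
    exact (pow_dvd_pow q (by omega)).trans hkm

lemma singularRootCount_eq_zero {q : ℕ} (hq : q.Prime) {l n : ℕ} (h : ¬ q * q ^ l ∣ n) :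
    singularRootCount q (q ^ l) n = 0 := by
  rw [singularRootCount, Nat.card_eq_zero]
  left
  constructor
  rintro ⟨_, hσ, π, rfl⟩
  refine h ?_
  rw [← Nat.card_fin n]
  refine dvd_card_of_forall_dvd_minimalPeriod π fun x => ?_
  have := hσ x
  rw [Equiv.Perm.coe_pow, minimalPeriod_iterate_eq_div_gcd (pow_ne_zero _ hq.ne_zero)] at this
  exact mul_dvd_of_dvd_div_gcd hq this

lemma minimalPeriod_apply_of_commute {α : Type*} {σ π : Equiv.Perm α} (h : Commute π σ) (x : α) :
    minimalPeriod σ (π x) = minimalPeriod σ x :=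
  minimalPeriod_eq_of_semiconj π.injective (fun y => Equiv.congr_fun h.eq y) x

lemma card_fiber_root {q : ℕ} (hq : q.Prime) (l : ℕ) {n : ℕ} (s : Finset (Fin n)) :
    Nat.card {σ : Equiv.Perm (Fin n) //
      Finset.univ.filter (fun x => q ∣ minimalPeriod σ x) = s ∧ ∃ π, π ^ q ^ l = σ} =
    singularRootCount q (q ^ l) s.card * cycleCount (fun j => ¬ q ∣ j) (n - s.card) := by
  rw [card_eq_mul_of_split (p := (· ∈ s))
    (Q := fun a => (∀ x, q ∣ minimalPeriod a x) ∧ ∃ π, π ^ q ^ l = a)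
    (R := fun b => ∀ y, ¬ q ∣ minimalPeriod b y),
    card_eq_singularRootCount q (q ^ l) (n := s.card) (by simp),
    card_eq_cycleCount (fun j => ¬ q ∣ j) (n := n - s.card)]
  · simp [Fintype.card_subtype_compl]
  · rintro σ ⟨rfl, -⟩ y
    simp [minimalPeriod_apply_of_commute (Commute.refl σ)]
  · intro a b
    constructor
    · rintro ⟨hs, π, hπ⟩
      have hmem : ∀ y, y ∈ s ↔ q ∣ minimalPeriod (a.subtypeCongr b) y := by simp [← hs]
      refine ⟨⟨fun x => ?_, ?_⟩, fun y => ?_⟩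
      · rw [← minimalPeriod_subtypeCongr_left a b, ← hmem]
        exact x.2
      · have hc : Commute π (a.subtypeCongr b) := hπ ▸ Commute.self_pow π _
        obtain ⟨a', b', rfl⟩ := exists_subtypeCongr_eq (p := (· ∈ s)) (σ := π) fun x => by
          rw [hmem, hmem, minimalPeriod_apply_of_commute hc]
        rw [← subtypeCongr_pow, subtypeCongr_inj] at hπ
        exact ⟨a', hπ.1⟩
      · rw [← minimalPeriod_subtypeCongr_right a b, ← hmem]
        exact y.2
    · rintro ⟨⟨ha, a', rfl⟩, hb⟩
      obtain ⟨b', rfl⟩ := exists_pow_eq_of_forall_not_dvd hq l b hb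
      refine ⟨?_, a'.subtypeCongr b', (subtypeCongr_pow _ _ _).symm⟩
      ext y
      simp only [Finset.mem_filter, Finset.mem_univ, true_and]
      by_cases hy : y ∈ s
      · simp only [hy, iff_true]
        exact minimalPeriod_subtypeCongr_left (a' ^ q ^ l) (b' ^ q ^ l) ⟨y, hy⟩ ▸ ha _
      · simp only [hy, iff_false]
        exact minimalPeriod_subtypeCongr_right (a' ^ q ^ l) (b' ^ q ^ l) ⟨y, hy⟩ ▸ hb _

lemma card_root_eq_sum {q : ℕ} (hq : q.Prime) (l n : ℕ) :
    Nat.card {σ : Equiv.Perm (Fin n) // ∃ π, π ^ q ^ l = σ} =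
      ∑ d ∈ Finset.range (n + 1), n.choose d *
        (singularRootCount q (q ^ l) d * cycleCount (fun j => ¬ q ∣ j) (n - d)) := by
  have h := Finset.sum_powerset_apply_card (fun d =>
    singularRootCount q (q ^ l) d * cycleCount (fun j => ¬ q ∣ j) (n - d))
    (x := (Finset.univ : Finset (Fin n)))
  simp only [Finset.card_univ, Fintype.card_fin, smul_eq_mul] at h
  rw [← h, Finset.powerset_univ, card_subtype_eq_sum_fiber _
    (fun σ : Equiv.Perm (Fin n) => Finset.univ.filter (fun x => q ∣ minimalPeriod σ x))]
  exact Finset.sum_congr rfl fun s _ => card_fiber_root hq l s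

lemma choose_succ_mul_le (n d : ℕ) (h : d ≤ n) :
    (n + 1).choose d * (n - d) ≤ n * n.choose d := by
  obtain ⟨m, rfl⟩ := Nat.exists_eq_add_of_le h
  have h1 := Nat.choose_mul_succ_eq (d + m) d
  rw [show d + m + 1 - d = m + 1 by omega] at h1
  rw [Nat.add_sub_cancel_left]
  refine Nat.le_of_mul_le_mul_right ?_ (Nat.succ_pos m)
  calc (d + m + 1).choose d * m * (m + 1) = (d + m + 1).choose d * (m + 1) * m := by ring
    _ = (d + m).choose d * ((d + m + 1) * m) := by rw [← h1]; ring
    _ ≤ (d + m).choose d * ((d + m) * (m + 1)) := Nat.mul_le_mul_left _ (by nlinarith)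
    _ = (d + m) * (d + m).choose d * (m + 1) := by ring

end Roots

end PermRoot


/-- for a prime power `r = q^l` and `n ≥ 1` with `q ∣ n+1` but
`qr ∤ n+1`, we have `n · |S_n^r| ≥ |S_{n+1}^r|`. -/
theorem stmt18 (q l r n : ℕ) (hq : Nat.Prime q) (hl : 1 ≤ l) (hr : r = q ^ l)
    (hn : 1 ≤ n) (h1 : q ∣ (n + 1)) (h2 : ¬ (q * r) ∣ (n + 1)) :
    n * Nat.card {σ : Equiv.Perm (Fin n) // ∃ π, π ^ r = σ} ≥
      Nat.card {σ : Equiv.Perm (Fin (n + 1)) // ∃ π, π ^ r = σ} := by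
  subst hr
  rw [ge_iff_le, PermRoot.card_root_eq_sum hq, PermRoot.card_root_eq_sum hq,
    Finset.sum_range_succ, PermRoot.singularRootCount_eq_zero hq h2, zero_mul, mul_zero, add_zero,
    Finset.mul_sum]
  refine Finset.sum_le_sum fun d hd => ?_
  have hdn : d ≤ n := by simpa [Nat.lt_succ_iff] using hd
  by_cases hdvd : q * q ^ l ∣ d
  · have hq' : q ∣ n - d + 1 := by
      have := Nat.dvd_sub h1 ((dvd_mul_right q _).trans hdvd)
      rwa [Nat.sub_add_comm hdn] at this
    rw [Nat.sub_add_comm hdn, PermRoot.cycleCount_succ_of_dvd hq']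
    calc _ = (n + 1).choose d * (n - d) * (PermRoot.singularRootCount q (q ^ l) d *
          PermRoot.cycleCount (fun j => ¬ q ∣ j) (n - d)) := by ring
      _ ≤ n * n.choose d * (PermRoot.singularRootCount q (q ^ l) d *
          PermRoot.cycleCount (fun j => ¬ q ∣ j) (n - d)) :=
        Nat.mul_le_mul_right _ (PermRoot.choose_succ_mul_le n d hdn)
      _ = _ := by ring
  · simp [PermRoot.singularRootCount_eq_zero hq hdvd]
end
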